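/- arXiv:2503.00157 — 2 statements merged into one kernel-verified Lean document; each statement's English description precedes it below -/
import Mathlib

section
/- There exist δ, R > 0 such that: (i) ‖∇f(m)‖ ≤ 1 − δ and |f(m) − m*| ≤ r for all m in the closed ball B̄(m*, r + δ); and (ii) |f(m) − m*| ≤ |m − m*| / max(4κ, 4κ²) for all m ∈ ℝ^d with f(m) ∉ B̄(m*, R), where κ = 1/σ². Moreover, for every m ∈ ℝ^d the Jacobian ∇f(m) is a symmetric positive-definite matrix, equal to κ times the covariance matrix of ν_m, and sup_{m ∈ ℝ^d} ‖∇f(m)‖ < ∞ (operator norm). -/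
open MeasureTheory Real Filter Set
open scoped RealInnerProductSpace ENNReal NNReal

noncomputable section

/-- `ℝ^d` as a Euclidean space. -/
abbrev Euc (d : ℕ) := EuclideanSpace ℝ (Fin d)

/-- The probability measure with density proportional to a given nonnegative function. -/
def probOfDensity {α : Type*} [MeasureSpace α] (g : α → ℝ) : Measure α :=
  (ENNReal.ofReal (∫ x, g x))⁻¹ • (volume.withDensity fun x => ENNReal.ofReal (g x))

/-- The probability measure `ν_m ∝ exp(−(1/σ²)[V(x) + |x−m|²/2])` on `ℝ^d`. -/
def nuMeas {d : ℕ} (σ : ℝ) (V : Euc d → ℝ) (m : Euc d) : Measure (Euc d) :=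
  probOfDensity (fun x => Real.exp (-(1 / σ ^ 2) * (V x + ‖x - m‖ ^ 2 / 2)))

/-- The mean of `ν_m`: `f(m) = ∫ x ν_m(dx)`. -/
def fMap {d : ℕ} (σ : ℝ) (V : Euc d → ℝ) (m : Euc d) : Euc d :=
  ∫ x, x ∂(nuMeas σ V m)


/-- The integral of `h` against the unnormalised weight `exp (-κ (V x + ‖x‖² / 2) + κ ⟪x, m⟫)`. -/
def tiltInt {d : ℕ} {F : Type*} [NormedAddCommGroup F] [NormedSpace ℝ F] (κ : ℝ) (V : Euc d → ℝ)
    (h : Euc d → F) (m : Euc d) : F :=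
  ∫ x, (exp (-κ * (V x + ‖x‖ ^ 2 / 2)) * exp (κ * ⟪x, m⟫)) • h x

lemma integrable_exp_mul_norm_sub_sq {d : ℕ} {b : ℝ} (hb : 0 < b) (B : ℝ) :
    Integrable fun x : Euc d => exp (B * ‖x‖ - b * ‖x‖ ^ 2) := by
  have h0 : Integrable fun x : Euc d => exp (-(b / 2) * ‖x‖ ^ 2) := by
    have := (GaussianFourier.integrable_cexp_neg_mul_sq_norm_add (V := Euc d)
      (b := ((b / 2 : ℝ) : ℂ)) (by simpa using hb) 0 0).norm
    refine this.congr (Eventually.of_forall fun x => ?_)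
    simp only [Complex.norm_exp]
    norm_cast
    simp
  refine (h0.const_mul (exp (B ^ 2 / (2 * b)))).mono' (by fun_prop)
    (Eventually.of_forall fun x => ?_)
  rw [norm_of_nonneg (exp_nonneg _), ← exp_add, exp_le_exp]
  have : B ^ 2 / (2 * b) - B * ‖x‖ + b / 2 * ‖x‖ ^ 2 = (B - b * ‖x‖) ^ 2 / (2 * b) := by
    field_simp
    ring
  have : 0 ≤ (B - b * ‖x‖) ^ 2 / (2 * b) := by positivity
  linarith

section Tilt

variable {d : ℕ} {F : Type*} [NormedAddCommGroup F] [NormedSpace ℝ F] {κ c : ℝ} {V : Euc d → ℝ}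

lemma integrable_tilt (hκ : 0 < κ) (hV : Continuous V) (hc : ∀ x, c ≤ V x)
    {h : Euc d → F} (hh : Continuous h) {A B : ℝ} (hb : ∀ x, ‖h x‖ ≤ A * exp (B * ‖x‖))
    (m : Euc d) :
    Integrable fun x => (exp (-κ * (V x + ‖x‖ ^ 2 / 2)) * exp (κ * ⟪x, m⟫)) • h x := by
  refine ((integrable_exp_mul_norm_sub_sq (d := d) (half_pos hκ) (κ * ‖m‖ + B)).const_mul
    (exp (-κ * c) * A)).mono' (Continuous.aestronglyMeasurable (by fun_prop))
    (Eventually.of_forall fun x => ?_)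
  have h1 : exp (-κ * (V x + ‖x‖ ^ 2 / 2)) * exp (κ * ⟪x, m⟫)
      ≤ exp (-κ * c) * exp (κ * ‖m‖ * ‖x‖ - κ / 2 * ‖x‖ ^ 2) := by
    rw [← exp_add, ← exp_add, exp_le_exp]
    have := mul_le_mul_of_nonneg_left (real_inner_le_norm x m) hκ.le
    have := mul_le_mul_of_nonneg_left (hc x) hκ.le
    linarith
  rw [norm_smul, norm_of_nonneg (by positivity)]
  calc _ ≤ (exp (-κ * c) * exp (κ * ‖m‖ * ‖x‖ - κ / 2 * ‖x‖ ^ 2)) * (A * exp (B * ‖x‖)) := by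
        gcongr
        exact hb x
    _ = _ := by
        rw [show (κ * ‖m‖ + B) * ‖x‖ - κ / 2 * ‖x‖ ^ 2
          = (κ * ‖m‖ * ‖x‖ - κ / 2 * ‖x‖ ^ 2) + B * ‖x‖ by ring, exp_add]
        ring

lemma norm_smul_innerSL_smulRight_le (hκ : 0 < κ) {h : Euc d → F} {A B : ℝ}
    (hb : ∀ x, ‖h x‖ ≤ A * exp (B * ‖x‖)) (x : Euc d) :
    ‖κ • (innerSL ℝ x).smulRight (h x)‖ ≤ (κ * A) * exp ((B + 1) * ‖x‖) := by
  rw [norm_smul, ContinuousLinearMap.norm_smulRight_apply, innerSL_apply_norm,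
    norm_of_nonneg hκ.le]
  have h1 : ‖x‖ ≤ exp ‖x‖ := by linarith [add_one_le_exp ‖x‖]
  calc κ * (‖x‖ * ‖h x‖) ≤ κ * (exp ‖x‖ * (A * exp (B * ‖x‖))) := by
        gcongr
        exact hb x
    _ = _ := by
        rw [add_mul, exp_add, one_mul]
        ring

lemma continuous_smul_innerSL_smulRight {h : Euc d → F} (hh : Continuous h) :
    Continuous fun x => κ • (innerSL ℝ x).smulRight (h x) := by
  fun_prop

/-- Differentiation under the integral sign for `tiltInt`. -/
lemma hasFDerivAt_tiltInt (hκ : 0 < κ) (hV : Continuous V) (hc : ∀ x, c ≤ V x)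
    {h : Euc d → F} (hh : Continuous h) {A B : ℝ} (hb : ∀ x, ‖h x‖ ≤ A * exp (B * ‖x‖))
    (m : Euc d) :
    HasFDerivAt (tiltInt κ V h)
      (tiltInt κ V (fun x => κ • (innerSL ℝ x).smulRight (h x)) m) m := by
  have hcont := continuous_smul_innerSL_smulRight (κ := κ) hh
  have hb' := norm_smul_innerSL_smulRight_le hκ hb
  refine hasFDerivAt_integral_of_dominated_of_fderiv_le
    (F := fun m x => (exp (-κ * (V x + ‖x‖ ^ 2 / 2)) * exp (κ * ⟪x, m⟫)) • h x)
    (F' := fun m x => (exp (-κ * (V x + ‖x‖ ^ 2 / 2)) * exp (κ * ⟪x, m⟫)) •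
      (κ • (innerSL ℝ x).smulRight (h x)))
    (bound := fun x => (exp (-κ * (V x + ‖x‖ ^ 2 / 2)) * exp (κ * ⟪x, (0 : Euc d)⟫)) •
      (exp (κ * ((‖m‖ + 1) * ‖x‖)) * ((κ * A) * exp ((B + 1) * ‖x‖))))
    (Metric.ball_mem_nhds m one_pos) ?_ (integrable_tilt hκ hV hc hh hb m) ?_ ?_ ?_ ?_
  · exact Eventually.of_forall fun m => (integrable_tilt hκ hV hc hh hb m).aestronglyMeasurable
  · exact (integrable_tilt hκ hV hc hcont hb' m).aestronglyMeasurable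
  · refine Eventually.of_forall fun x m' hm' => ?_
    have hm'' : ‖m'‖ ≤ ‖m‖ + 1 := by
      have := norm_sub_norm_le m' m
      rw [Metric.mem_ball, dist_eq_norm] at hm'
      linarith
    have hin : ⟪x, m'⟫ ≤ (‖m‖ + 1) * ‖x‖ := by
      refine (real_inner_le_norm x m').trans ?_
      rw [mul_comm]
      gcongr
    rw [norm_smul, norm_of_nonneg (by positivity), inner_zero_right, mul_zero, exp_zero, mul_one,
      smul_eq_mul, mul_assoc]
    gcongr
    exact hb' x
  · refine integrable_tilt hκ hV hc (by fun_prop) (A := κ * A)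
      (B := κ * (‖m‖ + 1) + (B + 1)) (fun x => ?_) 0
    have hA : 0 ≤ A := by simpa using (norm_nonneg _).trans (hb 0)
    rw [norm_of_nonneg (by positivity), add_mul (κ * (‖m‖ + 1)), exp_add, mul_assoc κ]
    exact le_of_eq (by ring_nf)
  · refine Eventually.of_forall fun x m' _ => ?_
    have h1 : HasFDerivAt (fun m : Euc d => κ * ⟪x, m⟫) (κ • innerSL ℝ x) m' :=
      ((innerSL ℝ x).hasFDerivAt).const_mul κ
    convert ((h1.exp.const_mul (exp (-κ * (V x + ‖x‖ ^ 2 / 2)))).smul_const (h x)) using 1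
    ext v
    simp [smul_smul]
    ring_nf

lemma continuous_tiltInt (hκ : 0 < κ) (hV : Continuous V) (hc : ∀ x, c ≤ V x)
    {h : Euc d → F} (hh : Continuous h) {A B : ℝ} (hb : ∀ x, ‖h x‖ ≤ A * exp (B * ‖x‖)) :
    Continuous (tiltInt κ V h) :=
  continuous_iff_continuousAt.2 fun m => (hasFDerivAt_tiltInt hκ hV hc hh hb m).continuousAt

lemma tiltInt_one_pos (hκ : 0 < κ) (hV : Continuous V) (hc : ∀ x, c ≤ V x) (m : Euc d) :
    0 < tiltInt κ V (fun _ => (1 : ℝ)) m := by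
  refine integral_pos_of_integrable_nonneg_nonzero (x := 0) (by fun_prop)
    (integrable_tilt hκ hV hc continuous_const (A := 1) (B := 0) (by simp) m)
    (fun x => ?_) ?_
  · simp only [Pi.zero_apply, smul_eq_mul, mul_one]
    positivity
  · simp only [smul_eq_mul, mul_one]
    positivity

end Tilt

section Gibbs

variable {d : ℕ} {F : Type*} [NormedAddCommGroup F] [NormedSpace ℝ F] {σ c : ℝ} {V : Euc d → ℝ}

lemma exp_neg_mul_add_norm_sub_sq (κ a : ℝ) (x m : Euc d) :
    exp (-κ * (a + ‖x - m‖ ^ 2 / 2))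
      = exp (-κ * (‖m‖ ^ 2 / 2)) * (exp (-κ * (a + ‖x‖ ^ 2 / 2)) * exp (κ * ⟪x, m⟫)) := by
  rw [← exp_add, ← exp_add, norm_sub_sq_real]
  ring_nf

lemma integral_exp_smul_eq_tiltInt (κ : ℝ) (V : Euc d → ℝ) (g : Euc d → F) (m : Euc d) :
    ∫ x, exp (-κ * (V x + ‖x - m‖ ^ 2 / 2)) • g x
      = exp (-κ * (‖m‖ ^ 2 / 2)) • tiltInt κ V g m := by
  simp_rw [exp_neg_mul_add_norm_sub_sq κ _ _ m, mul_smul _ _ (g _), tiltInt]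
  rw [integral_smul]
  simp_rw [mul_smul]

lemma integral_exp_eq_tiltInt (κ : ℝ) (V : Euc d → ℝ) (m : Euc d) :
    ∫ x, exp (-κ * (V x + ‖x - m‖ ^ 2 / 2))
      = exp (-κ * (‖m‖ ^ 2 / 2)) * tiltInt κ V (fun _ => (1 : ℝ)) m := by
  simpa using integral_exp_smul_eq_tiltInt κ V (fun _ => (1 : ℝ)) m

lemma integral_nuMeas_eq_integral_exp_smul (hV : Continuous V) (g : Euc d → F) (m : Euc d) :
    ∫ x, g x ∂(nuMeas σ V m) = (∫ x, exp (-(1 / σ ^ 2) * (V x + ‖x - m‖ ^ 2 / 2)))⁻¹ •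
      ∫ x, exp (-(1 / σ ^ 2) * (V x + ‖x - m‖ ^ 2 / 2)) • g x := by
  rw [nuMeas, probOfDensity, integral_smul_measure, ENNReal.toReal_inv,
    ENNReal.toReal_ofReal (integral_nonneg fun x => exp_nonneg _),
    integral_withDensity_eq_integral_toReal_smul (by fun_prop) (by simp)]
  simp_rw [ENNReal.toReal_ofReal (exp_nonneg _)]

lemma integral_nuMeas (hV : Continuous V) (g : Euc d → F) (m : Euc d) :
    ∫ x, g x ∂(nuMeas σ V m) =
      (tiltInt (1 / σ ^ 2) V (fun _ => (1 : ℝ)) m)⁻¹ • tiltInt (1 / σ ^ 2) V g m := by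
  rw [integral_nuMeas_eq_integral_exp_smul hV, integral_exp_smul_eq_tiltInt,
    integral_exp_eq_tiltInt, smul_smul, mul_inv, mul_assoc, mul_comm (_⁻¹) (exp _), ← mul_assoc,
    inv_mul_cancel₀ (exp_ne_zero _), one_mul]

lemma integral_exp_pos (hσ : 0 < σ) (hV : Continuous V) (hc : ∀ x, c ≤ V x) (m : Euc d) :
    0 < ∫ x, exp (-(1 / σ ^ 2) * (V x + ‖x - m‖ ^ 2 / 2)) := by
  rw [integral_exp_eq_tiltInt]
  exact mul_pos (exp_pos _) (tiltInt_one_pos (by positivity) hV hc m)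

lemma integrable_exp_smul (hσ : 0 < σ) (hV : Continuous V) (hc : ∀ x, c ≤ V x)
    {g : Euc d → F} (hg : Continuous g) {A B : ℝ} (hb : ∀ x, ‖g x‖ ≤ A * exp (B * ‖x‖))
    (m : Euc d) :
    Integrable fun x => exp (-(1 / σ ^ 2) * (V x + ‖x - m‖ ^ 2 / 2)) • g x := by
  have hκ : 0 < 1 / σ ^ 2 := by positivity
  refine ((integrable_tilt hκ hV hc hg hb m).smul (exp (-(1 / σ ^ 2) * (‖m‖ ^ 2 / 2)))).congr
    (Eventually.of_forall fun x => ?_)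
  simp only [exp_neg_mul_add_norm_sub_sq _ _ _ m, Pi.smul_apply, mul_smul]

lemma isProbabilityMeasure_nuMeas (hσ : 0 < σ) (hV : Continuous V) (hc : ∀ x, c ≤ V x)
    (m : Euc d) : IsProbabilityMeasure (nuMeas σ V m) := by
  have h0 := integral_exp_pos hσ hV hc m
  have hint := integrable_exp_smul hσ hV hc (continuous_const (y := (1 : ℝ)))
    (A := 1) (B := 0) (by simp) m
  simp only [smul_eq_mul, mul_one] at hint
  constructor
  rw [nuMeas, probOfDensity, Measure.smul_apply, withDensity_apply _ MeasurableSet.univ,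
    Measure.restrict_univ, ← ofReal_integral_eq_lintegral_ofReal hint
      (Eventually.of_forall fun x => exp_nonneg _), smul_eq_mul]
  exact ENNReal.inv_mul_cancel (by simpa using h0) (by simp)

lemma integrable_nuMeas (hσ : 0 < σ) (hV : Continuous V) (hc : ∀ x, c ≤ V x)
    {g : Euc d → F} (hg : Continuous g) {A B : ℝ} (hb : ∀ x, ‖g x‖ ≤ A * exp (B * ‖x‖))
    (m : Euc d) : Integrable g (nuMeas σ V m) := by
  refine Integrable.smul_measure ?_
    (by simpa using integral_exp_pos hσ hV hc m)
  rw [integrable_withDensity_iff_integrable_smul' (by fun_prop) (by simp)]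
  simp_rw [ENNReal.toReal_ofReal (exp_nonneg _)]
  exact integrable_exp_smul hσ hV hc hg hb m

lemma norm_le_exp_norm (x : Euc d) : ‖x‖ ≤ 1 * exp (1 * ‖x‖) := by
  linarith [add_one_le_exp (1 * ‖x‖)]

lemma norm_sub_le_exp (x a : Euc d) : ‖x - a‖ ≤ exp ‖a‖ * exp ‖x‖ := by
  rw [← exp_add]
  linarith [add_one_le_exp (‖a‖ + ‖x‖), norm_sub_le x a]

lemma integrable_inner_smul_sub (hσ : 0 < σ) (hV : Continuous V) (hc : ∀ x, c ≤ V x)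
    (m a v : Euc d) :
    Integrable (fun x => ⟪x - a, v⟫ • (x - a)) (nuMeas σ V m) := by
  refine integrable_nuMeas hσ hV hc (by fun_prop) (A := ‖v‖ * exp ‖a‖ ^ 2) (B := 2)
    (fun x => ?_) m
  rw [norm_smul]
  calc ‖⟪x - a, v⟫‖ * ‖x - a‖ ≤ (‖x - a‖ * ‖v‖) * ‖x - a‖ := by
        gcongr
        exact norm_inner_le_norm _ _
    _ = ‖v‖ * ‖x - a‖ ^ 2 := by ring
    _ ≤ ‖v‖ * (exp ‖a‖ * exp ‖x‖) ^ 2 := by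
        gcongr
        exact norm_sub_le_exp x a
    _ = _ := by
        rw [two_mul, exp_add]
        ring

lemma integrable_norm_sub_sq (hσ : 0 < σ) (hV : Continuous V) (hc : ∀ x, c ≤ V x)
    (m a : Euc d) : Integrable (fun x => ‖x - a‖ ^ 2) (nuMeas σ V m) := by
  refine integrable_nuMeas hσ hV hc (by fun_prop) (A := exp ‖a‖ ^ 2) (B := 2) (fun x => ?_) m
  rw [norm_of_nonneg (by positivity)]
  calc ‖x - a‖ ^ 2 ≤ (exp ‖a‖ * exp ‖x‖) ^ 2 := by
        gcongr
        exact norm_sub_le_exp x a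
    _ = _ := by
        rw [two_mul, exp_add]
        ring

lemma hasFDerivAt_fMap (hσ : 0 < σ) (hV : Continuous V) (hc : ∀ x, c ≤ V x) (m : Euc d) :
    HasFDerivAt (fMap σ V)
      ((tiltInt (1 / σ ^ 2) V (fun _ => (1 : ℝ)) m)⁻¹ •
          tiltInt (1 / σ ^ 2) V (fun x => (1 / σ ^ 2) • (innerSL ℝ x).smulRight x) m
        - ((tiltInt (1 / σ ^ 2) V (fun _ => (1 : ℝ)) m)⁻¹ •
          tiltInt (1 / σ ^ 2) V (fun x => (1 / σ ^ 2) • (innerSL ℝ x).smulRight (1 : ℝ)) m).smulRight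
            (fMap σ V m)) m := by
  have hκ : 0 < 1 / σ ^ 2 := by positivity
  have hZ := hasFDerivAt_tiltInt hκ hV hc (continuous_const (y := (1 : ℝ)))
    (A := 1) (B := 0) (by simp) m
  have hN := hasFDerivAt_tiltInt hκ hV hc continuous_id norm_le_exp_norm m
  have hpos := (tiltInt_one_pos hκ hV hc m).ne'
  have hf : fMap σ V = fun m => (tiltInt (1 / σ ^ 2) V (fun _ => (1 : ℝ)) m)⁻¹ •
      tiltInt (1 / σ ^ 2) V id m := funext fun m => integral_nuMeas hV id m
  rw [hf]
  refine (((hasDerivAt_inv hpos).comp_hasFDerivAt m hZ).smul hN).congr_fderiv ?_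
  ext1 v
  simp [smul_smul]
  module

lemma continuous_fderiv_fMap (hσ : 0 < σ) (hV : Continuous V) (hc : ∀ x, c ≤ V x) :
    Continuous (fderiv ℝ (fMap σ V)) := by
  have hκ : 0 < 1 / σ ^ 2 := by positivity
  have hf : Continuous (fMap σ V) := continuous_iff_continuousAt.2 fun m =>
    (hasFDerivAt_fMap hσ hV hc m).continuousAt
  have hZ := continuous_tiltInt hκ hV hc (continuous_const (y := (1 : ℝ)))
    (A := 1) (B := 0) (by simp)
  have hZ' := continuous_tiltInt hκ hV hc
    (continuous_smul_innerSL_smulRight (κ := 1 / σ ^ 2) (continuous_const (y := (1 : ℝ))))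
    (norm_smul_innerSL_smulRight_le hκ (h := fun _ => (1 : ℝ)) (A := 1) (B := 0) (by simp))
  have hN' := continuous_tiltInt hκ hV hc
    (continuous_smul_innerSL_smulRight (κ := 1 / σ ^ 2) continuous_id')
    (norm_smul_innerSL_smulRight_le hκ norm_le_exp_norm)
  have hinv := hZ.inv₀ fun m => (tiltInt_one_pos hκ hV hc m).ne'
  rw [funext fun m => (hasFDerivAt_fMap hσ hV hc m).fderiv]
  have h1 := hinv.smul hN'
  have h2 := hinv.smul hZ'
  exact h1.sub (((ContinuousLinearMap.smulRightL ℝ (Euc d) (Euc d)).continuous.comp h2).clm_apply hf)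

lemma fderiv_fMap_apply (hσ : 0 < σ) (hV : Continuous V) (hc : ∀ x, c ≤ V x) (m v : Euc d) :
    fderiv ℝ (fMap σ V) m v =
      (1 / σ ^ 2) • ∫ x, ⟪x - fMap σ V m, v⟫ • (x - fMap σ V m) ∂(nuMeas σ V m) := by
  have hκ : 0 < 1 / σ ^ 2 := by positivity
  have := isProbabilityMeasure_nuMeas hσ hV hc m
  have hN := integrable_nuMeas hσ hV hc
    (continuous_smul_innerSL_smulRight (κ := 1 / σ ^ 2) continuous_id')
    (norm_smul_innerSL_smulRight_le hκ norm_le_exp_norm) m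
  have hZ := integrable_nuMeas hσ hV hc
    (continuous_smul_innerSL_smulRight (κ := 1 / σ ^ 2) (continuous_const (y := (1 : ℝ))))
    (norm_smul_innerSL_smulRight_le hκ (h := fun _ => (1 : ℝ)) (A := 1) (B := 0) (by simp)) m
  have hid : Integrable (fun x => x) (nuMeas σ V m) :=
    integrable_nuMeas hσ hV hc continuous_id norm_le_exp_norm m
  have hinner : Integrable (fun x : Euc d => ⟪x, v⟫) (nuMeas σ V m) := hid.inner_const v
  have hmean : ∫ x, ⟪x, v⟫ ∂(nuMeas σ V m) = ⟪fMap σ V m, v⟫ := by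
    simp_rw [real_inner_comm v]
    exact integral_inner hid v
  have hq : Integrable (fun x : Euc d => ⟪x, v⟫ • x) (nuMeas σ V m) := by
    simpa using integrable_inner_smul_sub hσ hV hc m 0 v
  rw [(hasFDerivAt_fMap hσ hV hc m).fderiv, ← integral_nuMeas hV, ← integral_nuMeas hV,
    sub_apply, ContinuousLinearMap.smulRight_apply,
    ContinuousLinearMap.integral_apply hN, ContinuousLinearMap.integral_apply hZ]
  have hexp : ∀ x : Euc d, ⟪x - fMap σ V m, v⟫ • (x - fMap σ V m)
      = (⟪x, v⟫ • x - ⟪x, v⟫ • fMap σ V m) -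
        (⟪fMap σ V m, v⟫ • x - ⟪fMap σ V m, v⟫ • fMap σ V m) := fun x => by
    rw [inner_sub_left, sub_smul, smul_sub, smul_sub]
  simp_rw [hexp]
  have hfirst := hinner.smul_const (fMap σ V m)
  have hsecond := hid.fun_smul ⟪fMap σ V m, v⟫
  have hthird : Integrable (fun _ => ⟪fMap σ V m, v⟫ • fMap σ V m) (nuMeas σ V m) :=
    integrable_const _
  rw [integral_sub (f := fun x : Euc d => ⟪x, v⟫ • x - ⟪x, v⟫ • fMap σ V m)
    (g := fun x => ⟪fMap σ V m, v⟫ • x - ⟪fMap σ V m, v⟫ • fMap σ V m)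
    (hq.sub hfirst) (hsecond.sub hthird), integral_sub hq hfirst, integral_sub hsecond hthird,
    integral_smul_const, integral_smul, hmean]
  have : ∫ x, x ∂(nuMeas σ V m) = fMap σ V m := rfl
  simp [this, integral_const_mul, hmean, smul_sub, smul_smul]
  simp_rw [mul_smul, integral_smul]

lemma inner_fderiv_fMap (hσ : 0 < σ) (hV : Continuous V) (hc : ∀ x, c ≤ V x) (m v u : Euc d) :
    ⟪fderiv ℝ (fMap σ V) m v, u⟫ =
      (1 / σ ^ 2) * ∫ x, ⟪x - fMap σ V m, v⟫ * ⟪x - fMap σ V m, u⟫ ∂(nuMeas σ V m) := by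
  rw [fderiv_fMap_apply hσ hV hc, real_inner_smul_left, real_inner_comm u,
    ← integral_inner (integrable_inner_smul_sub hσ hV hc m _ v)]
  simp_rw [real_inner_smul_right, real_inner_comm u]

lemma fderiv_fMap_symmetric (hσ : 0 < σ) (hV : Continuous V) (hc : ∀ x, c ≤ V x)
    (m v u : Euc d) :
    ⟪fderiv ℝ (fMap σ V) m v, u⟫ = ⟪v, fderiv ℝ (fMap σ V) m u⟫ := by
  rw [real_inner_comm (fderiv ℝ (fMap σ V) m u) v, inner_fderiv_fMap hσ hV hc,
    inner_fderiv_fMap hσ hV hc]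
  simp_rw [mul_comm ⟪_, v⟫]

lemma inner_fderiv_fMap_self_pos (hσ : 0 < σ) (hV : Continuous V) (hc : ∀ x, c ≤ V x)
    (m : Euc d) {v : Euc d} (hv : v ≠ 0) : 0 < ⟪v, fderiv ℝ (fMap σ V) m v⟫ := by
  rw [← fderiv_fMap_symmetric hσ hV hc, inner_fderiv_fMap hσ hV hc,
    integral_nuMeas_eq_integral_exp_smul hV]
  refine mul_pos (by positivity) (smul_pos (inv_pos.2 (integral_exp_pos hσ hV hc m)) ?_)
  refine integral_pos_of_integrable_nonneg_nonzero (x := fMap σ V m + v) (by fun_prop) ?_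
    (fun x => smul_nonneg (exp_nonneg _) (mul_self_nonneg _)) ?_
  · refine integrable_exp_smul hσ hV hc (by fun_prop) (A := ‖v‖ ^ 2 * exp ‖fMap σ V m‖ ^ 2)
      (B := 2) (fun x => ?_) m
    rw [norm_mul]
    calc _ ≤ (‖x - fMap σ V m‖ * ‖v‖) * (‖x - fMap σ V m‖ * ‖v‖) := by
          gcongr <;> exact norm_inner_le_norm _ _
      _ = ‖v‖ ^ 2 * ‖x - fMap σ V m‖ ^ 2 := by ring
      _ ≤ ‖v‖ ^ 2 * (exp ‖fMap σ V m‖ * exp ‖x‖) ^ 2 := by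
          gcongr
          exact norm_sub_le_exp x _
      _ = _ := by
          rw [two_mul, exp_add]
          ring
  · simp [hv, (exp_pos _).ne']

lemma norm_fderiv_fMap_le (hσ : 0 < σ) (hV : Continuous V) (hc : ∀ x, c ≤ V x) (m : Euc d) :
    ‖fderiv ℝ (fMap σ V) m‖ ≤ (1 / σ ^ 2) * ∫ x, ‖x - fMap σ V m‖ ^ 2 ∂(nuMeas σ V m) := by
  refine ContinuousLinearMap.opNorm_le_bound _ (by positivity) fun v => ?_
  rw [fderiv_fMap_apply hσ hV hc, norm_smul, norm_of_nonneg (by positivity), mul_assoc]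
  gcongr
  rw [← integral_mul_const]
  refine norm_integral_le_of_norm_le ((integrable_norm_sub_sq hσ hV hc m _).mul_const _)
    (Eventually.of_forall fun x => ?_)
  rw [norm_smul]
  calc _ ≤ (‖x - fMap σ V m‖ * ‖v‖) * ‖x - fMap σ V m‖ := by
        gcongr
        exact norm_inner_le_norm _ _
    _ = _ := by ring

/-- The mean is close to any point around which the second moment is controlled. -/
lemma norm_fMap_sub_le (hσ : 0 < σ) (hV : Continuous V) (hc : ∀ x, c ≤ V x) {m a : Euc d} {K : ℝ}
    (hK : ∫ x, ‖x - a‖ ^ 2 ∂(nuMeas σ V m) ≤ K) : ‖fMap σ V m - a‖ ≤ K + 1 := by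
  have := isProbabilityMeasure_nuMeas hσ hV hc m
  have hid : Integrable (fun x => x) (nuMeas σ V m) :=
    integrable_nuMeas hσ hV hc continuous_id norm_le_exp_norm m
  have h2 := integrable_norm_sub_sq hσ hV hc m a
  have h1 : fMap σ V m - a = ∫ x, (x - a) ∂(nuMeas σ V m) := by
    rw [integral_sub hid (integrable_const _)]
    simp [fMap]
  rw [h1]
  refine (norm_integral_le_of_norm_le (h2.add (integrable_const (1 : ℝ)))
    (Eventually.of_forall fun x => ?_)).trans ?_
  · simp only [Pi.add_apply]
    nlinarith [sq_nonneg (‖x - a‖ - 1), norm_nonneg (x - a)]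
  · simp only [Pi.add_apply]
    rw [integral_add h2 (integrable_const _)]
    simpa using hK

lemma norm_fderiv_fMap_le_of_moment (hσ : 0 < σ) (hV : Continuous V) (hc : ∀ x, c ≤ V x)
    {m a : Euc d} {K : ℝ} (hK : ∫ x, ‖x - a‖ ^ 2 ∂(nuMeas σ V m) ≤ K) :
    ‖fderiv ℝ (fMap σ V) m‖ ≤ (1 / σ ^ 2) * (2 * K + 2 * (K + 1) ^ 2) := by
  have := isProbabilityMeasure_nuMeas hσ hV hc m
  refine (norm_fderiv_fMap_le hσ hV hc m).trans ?_
  gcongr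
  have hfa := norm_fMap_sub_le hσ hV hc hK
  have h2 := integrable_norm_sub_sq hσ hV hc m a
  calc ∫ x, ‖x - fMap σ V m‖ ^ 2 ∂(nuMeas σ V m)
      ≤ ∫ x, (2 * ‖x - a‖ ^ 2 + 2 * (K + 1) ^ 2) ∂(nuMeas σ V m) := by
        refine integral_mono (integrable_norm_sub_sq hσ hV hc m _)
          ((h2.const_mul 2).add (integrable_const _)) fun x => ?_
        have h3 : ‖x - fMap σ V m‖ ≤ ‖x - a‖ + (K + 1) := by
          have := norm_sub_le_norm_sub_add_norm_sub x a (fMap σ V m)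
          rw [norm_sub_rev a] at this
          linarith
        calc ‖x - fMap σ V m‖ ^ 2 ≤ (‖x - a‖ + (K + 1)) ^ 2 := by gcongr
          _ ≤ _ := by nlinarith [sq_nonneg (‖x - a‖ - (K + 1))]
    _ = 2 * ∫ x, ‖x - a‖ ^ 2 ∂(nuMeas σ V m) + 2 * (K + 1) ^ 2 := by
        rw [integral_add (h2.const_mul 2) (integrable_const _), integral_const_mul]
        simp
    _ ≤ _ := by linarith

end Gibbs

section Confinement

variable {d : ℕ}

/-- A function which is radially nondecreasing outside a ball is bounded below. -/
lemma exists_forall_le_of_inner_gradient_nonneg {V : Euc d → ℝ} (hV : Differentiable ℝ V) {R : ℝ}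
    (hR : 0 < R) (hgrad : ∀ x, R ≤ ‖x‖ → 0 ≤ ⟪x, gradient V x⟫) : ∃ c, ∀ x, c ≤ V x := by
  obtain ⟨y, -, hy⟩ := (isCompact_closedBall (0 : Euc d) R).exists_isMinOn
    ⟨0, by simp [hR.le]⟩ hV.continuous.continuousOn
  refine ⟨V y, fun x => ?_⟩
  rcases le_or_gt ‖x‖ R with hx | hx
  · exact hy (by simpa using hx)
  have hx0 : 0 < ‖x‖ := hR.trans hx
  have hderiv : ∀ t : ℝ, HasDerivAt (fun t : ℝ => V (t • x)) (fderiv ℝ V (t • x) x) t := fun t => by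
    have h1 : HasDerivAt (fun t : ℝ => t • x) x t := by
      simpa using (hasDerivAt_id t).smul_const x
    exact (hV (t • x)).hasFDerivAt.comp_hasDerivAt t h1
  have hmono : MonotoneOn (fun t : ℝ => V (t • x)) (Set.Ici (R / ‖x‖)) := by
    refine monotoneOn_of_deriv_nonneg (convex_Ici _)
      (fun t _ => (hderiv t).continuousAt.continuousWithinAt)
      (fun t _ => (hderiv t).differentiableAt.differentiableWithinAt) fun t ht => ?_
    rw [interior_Ici, mem_Ioi] at ht
    have ht0 : 0 < t := (div_pos hR hx0).trans ht
    have h1 := hgrad (t • x) (by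
      rw [norm_smul, norm_of_nonneg ht0.le]
      exact ((div_lt_iff₀ hx0).1 ht).le)
    rw [real_inner_smul_left, real_inner_comm, inner_gradient_left] at h1
    rw [(hderiv t).deriv]
    exact nonneg_of_mul_nonneg_right h1 ht0
  have h1 := hmono (self_mem_Ici) (mem_Ici.2 ((div_le_one hx0).2 hx.le)) ((div_le_one hx0).2 hx.le)
  simp only [one_smul] at h1
  refine le_trans (hy ?_) h1
  rw [mem_closedBall_zero_iff, norm_smul, norm_of_nonneg (by positivity),
    div_mul_cancel₀ _ hx0.ne']

/-- The tilted potential `x ↦ V x + ‖x - m‖² / 2` has a minimiser, which is a critical point. -/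
lemma exists_minimiser {V : Euc d → ℝ} (hV : Differentiable ℝ V) {c : ℝ} (hc : ∀ x, c ≤ V x)
    (m : Euc d) : ∃ a : Euc d, (∀ y, V a + ‖a - m‖ ^ 2 / 2 ≤ V y + ‖y - m‖ ^ 2 / 2) ∧
      ⟪a, gradient V a⟫ + ‖a‖ ^ 2 = ⟪a, m⟫ := by
  have hlim : Tendsto (fun x => V x + ‖x - m‖ ^ 2 / 2) (cocompact (Euc d)) atTop := by
    have h1 : Tendsto (fun x : Euc d => ‖x - m‖) (cocompact (Euc d)) atTop := by
      refine tendsto_atTop_mono (fun x => norm_sub_norm_le x m) ?_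
      exact tendsto_atTop_add_const_right _ (-‖m‖) (tendsto_norm_cocompact_atTop (E := Euc d))
    exact tendsto_atTop_add_left_of_le _ c hc
      (((tendsto_pow_atTop two_ne_zero).comp h1).atTop_div_const two_pos)
  have hcont := hV.continuous
  obtain ⟨a, ha⟩ := Continuous.exists_forall_le (by fun_prop) hlim
  refine ⟨a, ha, ?_⟩
  have h1 : HasFDerivAt (fun x : Euc d => ‖x - m‖ ^ 2) (2 • innerSL ℝ (a - m)) a := by
    simpa using ((hasFDerivAt_id a).sub_const m).norm_sq
  have h2 := (hV a).hasFDerivAt.add (h1.mul_const (1 / 2))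
  have h3 : IsLocalMin (V + fun x => ‖x - m‖ ^ 2 * (1 / 2)) a :=
    Eventually.of_forall fun y => by
      have := ha y
      simp only [Pi.add_apply]
      linarith
  have h4 := congrArg (fun l : Euc d →L[ℝ] ℝ => l a) (h3.hasFDerivAt_eq_zero h2)
  simp at h4
  rw [real_inner_comm, inner_gradient_left, real_inner_comm m a]
  linarith

/-- A second moment bound around an approximate centre of convexity `a` of the potential `U`. -/
lemma integral_exp_mul_norm_sub_sq_le {U : Euc d → ℝ} {κ C : ℝ} (hκ : 0 < κ) {a : Euc d}
    (hmid : ∀ x, U ((1 / 2 : ℝ) • (x - a) + a) + ‖x - a‖ ^ 2 / 8 ≤ U x + C)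
    (hint : Integrable fun x => exp (-κ * U x)) :
    ∫ x, exp (-κ * U x) * ‖x - a‖ ^ 2
      ≤ (2 ^ d * (exp (κ * C) * (8 / κ))) * ∫ x, exp (-κ * U x) := by
  have hG : Integrable fun y => exp (-κ * U (y + a)) := hint.comp_add_right a
  have hhalf : Integrable fun y : Euc d => exp (-κ * U ((1 / 2 : ℝ) • y + a)) :=
    hG.comp_smul (by norm_num)
  have key : ∀ y : Euc d, exp (-κ * U (y + a)) * ‖y‖ ^ 2
      ≤ (exp (κ * C) * (8 / κ)) * exp (-κ * U ((1 / 2 : ℝ) • y + a)) := fun y => by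
    have h1 := hmid (y + a)
    rw [add_sub_cancel_right] at h1
    have h2 : ‖y‖ ^ 2 ≤ (8 / κ) * exp (κ / 8 * ‖y‖ ^ 2) := by
      have : κ / 8 * ‖y‖ ^ 2 ≤ exp (κ / 8 * ‖y‖ ^ 2) := by
        linarith [add_one_le_exp (κ / 8 * ‖y‖ ^ 2)]
      calc ‖y‖ ^ 2 = (8 / κ) * (κ / 8 * ‖y‖ ^ 2) := by field_simp
        _ ≤ _ := by gcongr
    calc exp (-κ * U (y + a)) * ‖y‖ ^ 2
        ≤ exp (-κ * U (y + a)) * ((8 / κ) * exp (κ / 8 * ‖y‖ ^ 2)) := by gcongr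
      _ = (8 / κ) * exp (-κ * U (y + a) + κ / 8 * ‖y‖ ^ 2) := by
          rw [exp_add]
          ring
      _ ≤ (8 / κ) * exp (κ * C + -κ * U ((1 / 2 : ℝ) • y + a)) := by
          have := mul_le_mul_of_nonneg_left h1 hκ.le
          refine mul_le_mul_of_nonneg_left (exp_le_exp.2 ?_) (by positivity)
          linarith
      _ = _ := by
          rw [exp_add]
          ring
  have hscale := Measure.integral_comp_smul (volume : Measure (Euc d))
    (fun y => exp (-κ * U (y + a))) (1 / 2 : ℝ)
  have hconst : |((1 / 2 : ℝ) ^ Module.finrank ℝ (Euc d))⁻¹| = 2 ^ d := by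
    rw [finrank_euclideanSpace_fin, ← inv_pow, abs_of_nonneg (by positivity)]
    norm_num
  rw [hconst, smul_eq_mul, integral_add_right_eq_self (fun y => exp (-κ * U y)) a] at hscale
  calc ∫ x, exp (-κ * U x) * ‖x - a‖ ^ 2 = ∫ y, exp (-κ * U (y + a)) * ‖y‖ ^ 2 := by
        rw [← integral_add_right_eq_self (fun x => exp (-κ * U x) * ‖x - a‖ ^ 2) a]
        simp
    _ ≤ ∫ y, (exp (κ * C) * (8 / κ)) * exp (-κ * U ((1 / 2 : ℝ) • y + a)) :=
        integral_mono_of_nonneg (Eventually.of_forall fun y => by positivity)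
          (hhalf.const_mul _) (Eventually.of_forall key)
    _ = _ := by
        rw [integral_const_mul, hscale]
        ring

/-- The second moment of `ν_m` around a minimiser of its potential is bounded uniformly in `m`. -/
lemma integral_nuMeas_norm_sub_sq_le {V Vc Vb : Euc d → ℝ} {σ c Mb : ℝ} (hσ : 0 < σ)
    (hV : Continuous V) (hc : ∀ x, c ≤ V x) (hdec : ∀ x, V x = Vc x + Vb x)
    (hVc : ConvexOn ℝ Set.univ Vc) (hVb : ∀ x, |Vb x| ≤ Mb) {m a : Euc d}
    (ha : ∀ y, V a + ‖a - m‖ ^ 2 / 2 ≤ V y + ‖y - m‖ ^ 2 / 2) :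
    ∫ x, ‖x - a‖ ^ 2 ∂(nuMeas σ V m)
      ≤ 2 ^ d * (exp (1 / σ ^ 2 * (2 * Mb)) * (8 / (1 / σ ^ 2))) := by
  have hκ : 0 < 1 / σ ^ 2 := by positivity
  have hint := integrable_exp_smul hσ hV hc (continuous_const (y := (1 : ℝ)))
    (A := 1) (B := 0) (by simp) m
  simp only [smul_eq_mul, mul_one] at hint
  rw [integral_nuMeas_eq_integral_exp_smul hV, smul_eq_mul,
    inv_mul_le_iff₀ (integral_exp_pos hσ hV hc m), mul_comm]
  refine integral_exp_mul_norm_sub_sq_le (U := fun x => V x + ‖x - m‖ ^ 2 / 2) hκ (fun x => ?_) hint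
  have h1 : Vc ((1 / 2 : ℝ) • (x - a) + a) ≤ 1 / 2 * Vc x + 1 / 2 * Vc a := by
    have := hVc.2 (mem_univ x) (mem_univ a) (half_pos one_pos).le (half_pos one_pos).le
      (add_halves 1)
    simp only [smul_eq_mul] at this
    rwa [show (1 / 2 : ℝ) • (x - a) + a = (1 / 2 : ℝ) • x + (1 / 2 : ℝ) • a by module]
  have h2 : ‖(1 / 2 : ℝ) • (x - a) + a - m‖ ^ 2
      = ‖x - m‖ ^ 2 / 2 + ‖a - m‖ ^ 2 / 2 - ‖x - a‖ ^ 2 / 4 := by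
    have := parallelogram_law_with_norm ℝ (x - m) (a - m)
    rw [show x - m - (a - m) = x - a by abel] at this
    rw [show (1 / 2 : ℝ) • (x - a) + a - m = (1 / 2 : ℝ) • ((x - m) + (a - m)) by module,
      norm_smul, mul_pow]
    norm_num
    nlinarith
  have h3 := ha x
  have h4 := abs_le.1 (hVb x)
  have h5 := abs_le.1 (hVb a)
  have h6 := abs_le.1 (hVb ((1 / 2 : ℝ) • (x - a) + a))
  simp only [hdec] at h3 ⊢
  rw [h2]
  linarith

end Confinement

section Contraction

variable {d : ℕ}

/-- A `C¹` map contracting on a closed ball around a fixed point maps a slightly larger ball into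
the original one, and is uniformly contracting there. -/
lemma exists_contraction_on_larger_ball {f : Euc d → Euc d} (hf : Differentiable ℝ f)
    (hf' : Continuous (fderiv ℝ f)) {p : Euc d} (hp : f p = p) {r : ℝ} (hr : 0 < r)
    (hcontr : ∀ m ∈ Metric.closedBall p r, ‖fderiv ℝ f m‖ < 1) :
    ∃ δ : ℝ, 0 < δ ∧ ∀ m ∈ Metric.closedBall p (r + δ),
      ‖fderiv ℝ f m‖ ≤ 1 - δ ∧ ‖f m - p‖ ≤ r := by
  obtain ⟨m₀, hm₀, hmax⟩ := (isCompact_closedBall p r).exists_isMaxOn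
    ⟨p, Metric.mem_closedBall_self hr.le⟩ hf'.norm.continuousOn
  obtain ⟨η, hη0, hη⟩ : ∃ η, 0 < η ∧ ‖fderiv ℝ f m₀‖ < 1 - η :=
    ⟨(1 - ‖fderiv ℝ f m₀‖) / 2, by linarith [hcontr m₀ hm₀], by linarith [hcontr m₀ hm₀]⟩
  obtain ⟨δ₁, hδ₁, hsub⟩ := (isCompact_closedBall p r).exists_cthickening_subset_open
    (isOpen_lt hf'.norm continuous_const : IsOpen {m | ‖fderiv ℝ f m‖ < 1 - η})
    fun m hm => (hmax hm).trans_lt hη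
  rw [cthickening_closedBall hδ₁.le hr.le] at hsub
  refine ⟨min δ₁ (min η (η * r)), by positivity, fun m hm => ?_⟩
  set δ := min δ₁ (min η (η * r)) with hδ
  have hd1 : δ ≤ δ₁ := min_le_left _ _
  have hd2 : δ ≤ η := (min_le_right _ _).trans (min_le_left _ _)
  have hd3 : δ ≤ η * r := (min_le_right _ _).trans (min_le_right _ _)
  have hd0 : 0 < δ := by positivity
  have hbound : ∀ x ∈ Metric.closedBall p (r + δ), ‖fderiv ℝ f x‖ ≤ 1 - η := fun x hx =>
    (hsub (Metric.closedBall_subset_closedBall (by linarith) hx)).le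
  refine ⟨(hbound m hm).trans (by linarith), ?_⟩
  have h1 := (convex_closedBall p (r + δ)).norm_image_sub_le_of_norm_fderiv_le
    (fun x _ => hf x) hbound (Metric.mem_closedBall_self (by positivity)) hm
  rw [hp] at h1
  have hη1 : 0 ≤ 1 - η := (norm_nonneg _).trans hη.le
  rw [Metric.mem_closedBall, dist_eq_norm] at hm
  calc ‖f m - p‖ ≤ (1 - η) * ‖m - p‖ := h1
    _ ≤ (1 - η) * (r + δ) := by gcongr
    _ ≤ r := by nlinarith [mul_pos hη0 hd0]

/-- If `f m` stays close to a critical point of the tilted potential `V + ‖· - m‖² / 2` and `V` grows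
superquadratically, then `f` grows sublinearly. -/
lemma exists_radius_norm_sub_le {V : Euc d → ℝ} {β R_V C D : ℝ} (hβ : 2 < β) (hC : 0 < C)
    (hgrow : ∀ x : Euc d, R_V ≤ ‖x‖ → ‖x‖ ^ β ≤ ⟪x, gradient V x⟫) {f : Euc d → Euc d}
    (hf : ∀ m, ∃ a, ⟪a, gradient V a⟫ + ‖a‖ ^ 2 = ⟪a, m⟫ ∧ ‖f m - a‖ ≤ D) (p : Euc d) :
    ∃ R : ℝ, 0 < R ∧ ∀ m, R < ‖f m - p‖ → ‖f m - p‖ ≤ ‖m - p‖ / C := by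
  obtain ⟨R₀, hR₀⟩ := eventually_atTop.1
    ((tendsto_rpow_atTop (sub_pos.2 hβ)).eventually_ge_atTop (4 * C))
  have hD : 0 ≤ D := by
    obtain ⟨a, -, ha⟩ := hf p
    exact (norm_nonneg _).trans ha
  obtain ⟨R₁, h0, h1, h2, h3, h4⟩ : ∃ R₁ : ℝ, R₀ ≤ R₁ ∧ R_V ≤ R₁ ∧ ‖p‖ / (2 * C) ≤ R₁ ∧
      D + ‖p‖ ≤ R₁ ∧ 1 ≤ R₁ :=
    ⟨max R₀ (max R_V (max (‖p‖ / (2 * C)) (max (D + ‖p‖) 1))), by simp⟩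
  refine ⟨R₁ + D + ‖p‖, by positivity, fun m hm => ?_⟩
  obtain ⟨a, hcrit, ha⟩ := hf m
  have htri : ‖f m - p‖ ≤ D + ‖a‖ + ‖p‖ := by
    calc ‖f m - p‖ = ‖(f m - a) + a - p‖ := by congr 1; abel
      _ ≤ ‖f m - a‖ + ‖a‖ + ‖p‖ := (norm_sub_le _ _).trans (by gcongr; exact norm_add_le _ _)
      _ ≤ _ := by gcongr
  have haR : R₁ < ‖a‖ := by linarith
  have ha0 : 0 < ‖a‖ := by linarith
  have hpow : ‖a‖ ^ β = ‖a‖ ^ (β - 2) * ‖a‖ ^ 2 := by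
    rw [← rpow_natCast, ← rpow_add ha0]
    norm_num
  have hpow' : 4 * C * ‖a‖ ^ 2 ≤ ‖a‖ * ‖m‖ := by
    calc 4 * C * ‖a‖ ^ 2 ≤ ‖a‖ ^ (β - 2) * ‖a‖ ^ 2 := by
          gcongr
          exact hR₀ _ (by linarith)
      _ = ‖a‖ ^ β := hpow.symm
      _ ≤ ⟪a, gradient V a⟫ := hgrow a (by linarith)
      _ ≤ ⟪a, m⟫ := by linarith [sq_nonneg ‖a‖]
      _ ≤ _ := real_inner_le_norm a m
  have ham : 4 * C * ‖a‖ ≤ ‖m‖ := le_of_mul_le_mul_left (by linarith) ha0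
  have hpa : ‖p‖ ≤ 2 * C * ‖a‖ := by
    rw [div_le_iff₀ (by positivity)] at h2
    have := mul_le_mul_of_nonneg_right haR.le (by positivity : 0 ≤ 2 * C)
    linarith
  rw [le_div_iff₀ hC]
  have := mul_le_mul_of_nonneg_right (show ‖f m - p‖ ≤ 2 * ‖a‖ by linarith) hC.le
  linarith [norm_sub_norm_le m p]

end Contraction

/-- **Proposition (properties of `f` in dimension `d`).** -/
theorem fMap_properties
    (d : ℕ) (hd : 1 ≤ d) (σ : ℝ) (hσ : 0 < σ)
    -- confining potential V
    (V Vc Vb : Euc d → ℝ) (hV : ContDiff ℝ 2 V) (hdec : ∀ x, V x = Vc x + Vb x)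
    (ρ₀ : ℝ) (hρ₀ : 0 < ρ₀) (hVc : StrongConvexOn Set.univ ρ₀ Vc)
    (Mb : ℝ) (hVb : ∀ x, |Vb x| ≤ Mb)
    (β R_V θ₀ : ℝ) (hβ : 2 < β) (hRV : 0 < R_V) (hθ₀ : 0 < θ₀)
    (hgrow : ∀ x : Euc d, R_V ≤ ‖x‖ →
      ⟪x, gradient V x⟫ ≥ ‖x‖ ^ β ∧ ‖gradient V x‖ ≤ ‖x‖ ^ θ₀)
    (L : ℝ) (hL : 0 < L)
    (hOS : ∀ x y : Euc d, ⟪gradient V x - gradient V y, x - y⟫ ≥ -L * ‖x - y‖ ^ 2)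
    -- fixed point and local contraction
    (mstar : Euc d) (hfixstar : fMap σ V mstar = mstar)
    (r : ℝ) (hr : 0 < r)
    (hcontr : ∀ m ∈ Metric.closedBall mstar r, ‖fderiv ℝ (fMap σ V) m‖ < 1) :
    ∃ δ : ℝ, 0 < δ ∧ ∃ R : ℝ, 0 < R ∧
      -- (i) contraction and stability on the enlarged ball
      (∀ m ∈ Metric.closedBall mstar (r + δ),
        ‖fderiv ℝ (fMap σ V) m‖ ≤ 1 - δ ∧ ‖fMap σ V m - mstar‖ ≤ r) ∧
      -- (ii) strong contraction far away
      (∀ m : Euc d, fMap σ V m ∉ Metric.closedBall mstar R →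
        ‖fMap σ V m - mstar‖ ≤ ‖m - mstar‖ / max (4 * (1 / σ ^ 2)) (4 * (1 / σ ^ 2) ^ 2)) ∧
      -- the Jacobian is symmetric
      (∀ (m v u : Euc d), ⟪fderiv ℝ (fMap σ V) m v, u⟫ = ⟪v, fderiv ℝ (fMap σ V) m u⟫) ∧
      -- positive definite
      (∀ (m v : Euc d), v ≠ 0 → 0 < ⟪v, fderiv ℝ (fMap σ V) m v⟫) ∧
      -- equal to κ times the covariance of ν_m
      (∀ (m v : Euc d), fderiv ℝ (fMap σ V) m v =
        (1 / σ ^ 2) • ∫ x, ⟪x - fMap σ V m, v⟫ • (x - fMap σ V m) ∂(nuMeas σ V m)) ∧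
      -- uniformly bounded in operator norm
      (∃ M : ℝ, ∀ m : Euc d, ‖fderiv ℝ (fMap σ V) m‖ ≤ M) := by
  have hVd : Differentiable ℝ V := hV.differentiable (by norm_num)
  have hVcont : Continuous V := hVd.continuous
  obtain ⟨c, hc⟩ := exists_forall_le_of_inner_gradient_nonneg hVd hRV fun x hx =>
    (rpow_nonneg (norm_nonneg x) β).trans (hgrow x hx).1
  have hVc' : ConvexOn ℝ Set.univ Vc :=
    UniformConvexOn.convexOn hVc fun t => by simpa using by positivity
  obtain ⟨K, hK⟩ : ∃ K : ℝ, ∀ m, ∃ a : Euc d, ⟪a, gradient V a⟫ + ‖a‖ ^ 2 = ⟪a, m⟫ ∧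
      ∫ x, ‖x - a‖ ^ 2 ∂(nuMeas σ V m) ≤ K := by
    refine ⟨2 ^ d * (exp (1 / σ ^ 2 * (2 * Mb)) * (8 / (1 / σ ^ 2))), fun m => ?_⟩
    obtain ⟨a, ha, hcrit⟩ := exists_minimiser hVd hc m
    exact ⟨a, hcrit, integral_nuMeas_norm_sub_sq_le hσ hVcont hc hdec hVc' hVb ha⟩
  obtain ⟨δ, hδ, hball⟩ := exists_contraction_on_larger_ball
    (fun m => (hasFDerivAt_fMap hσ hVcont hc m).differentiableAt)
    (continuous_fderiv_fMap hσ hVcont hc) hfixstar hr hcontr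
  obtain ⟨R, hR, hfar⟩ := exists_radius_norm_sub_le hβ
    (lt_max_of_lt_left (by positivity) : 0 < max (4 * (1 / σ ^ 2)) (4 * (1 / σ ^ 2) ^ 2))
    (fun x hx => (hgrow x hx).1) (f := fMap σ V) (D := K + 1) (fun m => by
      obtain ⟨a, hcrit, hmom⟩ := hK m
      exact ⟨a, hcrit, norm_fMap_sub_le hσ hVcont hc hmom⟩) mstar
  refine ⟨δ, hδ, R, hR, hball, fun m hm => hfar m ?_,
    fderiv_fMap_symmetric hσ hVcont hc, fun m v hv => inner_fderiv_fMap_self_pos hσ hVcont hc m hv,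
    fderiv_fMap_apply hσ hVcont hc, (1 / σ ^ 2) * (2 * K + 2 * (K + 1) ^ 2), fun m => ?_⟩
  · simpa [dist_eq_norm] using hm
  · obtain ⟨a, -, hmom⟩ := hK m
    exact norm_fderiv_fMap_le_of_moment hσ hVcont hc hmom

end
end

section
/- The function w is differentiable with w'(θ) = θ/κ − f(r(θ)/κ) for all θ ∈ ℝ; κm* is the unique critical point of w; there exists η > 0 such that (θ − κm*)·w'(θ) ≥ η·(θ − κm*)² for all θ ∈ ℝ; and w'' is bounded below. -/
open MeasureTheory Real Filter Set
open scoped ENNReal NNReal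

noncomputable section

/-- The unnormalized density of `ν_m`: `x ↦ exp(−(1/σ²)[V(x) + (x−m)²/2])`. -/
def nuDens (σ : ℝ) (V : ℝ → ℝ) (m x : ℝ) : ℝ :=
  Real.exp (-(1 / σ ^ 2) * (V x + (x - m) ^ 2 / 2))

/-- The mean of `ν_m`: `f(m) = ∫ x ν_m(dx)`. -/
def fFun (σ : ℝ) (V : ℝ → ℝ) (m : ℝ) : ℝ :=
  (∫ x, x * nuDens σ V m x) / ∫ x, nuDens σ V m x

/-- A probability density on `ℝ` with finite second moment, integrable entropy and
integrable energy. -/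
structure AdmissibleDensity1 (V₀ : ℝ → ℝ) (ρ : ℝ → ℝ) : Prop where
  meas : Measurable ρ
  nonneg : ∀ x, 0 ≤ ρ x
  total : (∫ x, ρ x) = 1
  mom2 : Integrable (fun x => ρ x * x ^ 2)
  ent : Integrable (fun x => ρ x * Real.log (ρ x))
  energy : Integrable (fun x => ρ x * V₀ x)

/-- The mean `m_μ = ∫ x μ(x) dx` of a density on `ℝ`. -/
def densMean1 (ρ : ℝ → ℝ) : ℝ := ∫ x, ρ x * x

/-- The free energy `F_θ(μ) = ∫ (V₀(x) − xθ) μ(x) dx + h(m_μ) + ∫ μ log μ`. -/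
def freeEnergy1 (V₀ h : ℝ → ℝ) (θ : ℝ) (ρ : ℝ → ℝ) : ℝ :=
  (∫ x, ρ x * (V₀ x - x * θ)) + h (densMean1 ρ) + ∫ x, ρ x * Real.log (ρ x)

/-- `w(θ) = θ²/(2κ) + inf_μ F_θ(μ)`. -/
def wFun1 (V₀ h : ℝ → ℝ) (κ θ : ℝ) : ℝ :=
  θ ^ 2 / (2 * κ) +
    sInf {s : ℝ | ∃ ρ, AdmissibleDensity1 V₀ ρ ∧ s = freeEnergy1 V₀ h θ ρ}

/-- Real functions growing faster than every quadratic polynomial. -/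
def SuperQuadratic (U : ℝ → ℝ) : Prop := ∀ A : ℝ, ∃ C : ℝ, ∀ x, A * x ^ 2 - C ≤ U x

/-- The unnormalized exponential moment `∫ xⁿ exp(t x − U x) dx`. -/
def tiltedMoment (U : ℝ → ℝ) (n : ℕ) (t : ℝ) : ℝ := ∫ x, x ^ n * exp (t * x - U x)

/-- The mean of the Gibbs density proportional to `exp(t x − U x)`. -/
def gibbsMean (U : ℝ → ℝ) (t : ℝ) : ℝ := tiltedMoment U 1 t / tiltedMoment U 0 t

/-- The probability density proportional to `exp(t x − U x)`. -/
def gibbsDensity (U : ℝ → ℝ) (t x : ℝ) : ℝ := exp (t * x - U x) / tiltedMoment U 0 t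

theorem SuperQuadratic.integrable_exp {U : ℝ → ℝ} (hU : SuperQuadratic U) (hc : Continuous U)
    (t : ℝ) : Integrable fun x => exp (t * x - U x) := by
  obtain ⟨C, hC⟩ := hU (1 + t ^ 2)
  refine ((integrable_exp_neg_mul_sq one_pos).const_mul (exp (C + 1))).mono'
    (by fun_prop) (.of_forall fun x => ?_)
  rw [norm_of_nonneg (exp_pos _).le, ← exp_add]
  apply exp_le_exp.2
  nlinarith [hC x, sq_nonneg (t * x - 1)]

theorem SuperQuadratic.bddBelow {U : ℝ → ℝ} (hU : SuperQuadratic U) : ∃ C, ∀ x, -C ≤ U x := by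
  obtain ⟨C, hC⟩ := hU 0
  exact ⟨C, fun x => by simpa using hC x⟩

theorem integrable_withDensity_exp_neg {U f : ℝ → ℝ} (hc : Continuous U) :
    Integrable f (volume.withDensity fun x => ENNReal.ofReal (exp (-U x))) ↔
      Integrable fun x => f x * exp (-U x) := by
  rw [integrable_withDensity_iff_integrable_smul' (by fun_prop) (by simp)]
  simp [ENNReal.toReal_ofReal, (exp_pos _).le, mul_comm]

theorem integral_withDensity_exp_neg {U : ℝ → ℝ} (hc : Continuous U) (f : ℝ → ℝ) :
    ∫ x, f x ∂(volume.withDensity fun x => ENNReal.ofReal (exp (-U x))) =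
      ∫ x, f x * exp (-U x) := by
  rw [integral_withDensity_eq_integral_toReal_smul (by fun_prop) (by simp)]
  simp [ENNReal.toReal_ofReal, (exp_pos _).le, mul_comm]

theorem SuperQuadratic.integrableExpSet_eq_univ {U : ℝ → ℝ} (hU : SuperQuadratic U)
    (hc : Continuous U) : ProbabilityTheory.integrableExpSet id
      (volume.withDensity fun x => ENNReal.ofReal (exp (-U x))) = univ := by
  refine eq_univ_of_forall fun t => ?_
  rw [ProbabilityTheory.integrableExpSet, mem_ofPred_eq, integrable_withDensity_exp_neg hc]
  simpa [← exp_add, ← sub_eq_add_neg] using hU.integrable_exp hc t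

theorem SuperQuadratic.mem_interior_integrableExpSet {U : ℝ → ℝ} (hU : SuperQuadratic U)
    (hc : Continuous U) (t : ℝ) : t ∈ interior (ProbabilityTheory.integrableExpSet id
      (volume.withDensity fun x => ENNReal.ofReal (exp (-U x)))) := by
  rw [hU.integrableExpSet_eq_univ hc, interior_univ]
  trivial

theorem SuperQuadratic.integrable_pow_mul_exp {U : ℝ → ℝ} (hU : SuperQuadratic U)
    (hc : Continuous U) (n : ℕ) (t : ℝ) : Integrable fun x => x ^ n * exp (t * x - U x) := by
  have := ProbabilityTheory.integrable_pow_mul_exp_of_mem_interior_integrableExpSet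
    (hU.mem_interior_integrableExpSet hc t) n
  rw [integrable_withDensity_exp_neg hc] at this
  simpa [mul_assoc, ← exp_add, ← sub_eq_add_neg] using this

theorem SuperQuadratic.hasDerivAt_tiltedMoment {U : ℝ → ℝ} (hU : SuperQuadratic U)
    (hc : Continuous U) (n : ℕ) (t : ℝ) :
    HasDerivAt (tiltedMoment U n) (tiltedMoment U (n + 1) t) t := by
  have := ProbabilityTheory.hasDerivAt_integral_pow_mul_exp_real
    (hU.mem_interior_integrableExpSet hc t) n
  simp_rw [integral_withDensity_exp_neg hc] at this
  simp only [id_eq, mul_assoc, ← exp_add, ← sub_eq_add_neg] at this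
  exact this

theorem SuperQuadratic.tiltedMoment_zero_pos {U : ℝ → ℝ} (hU : SuperQuadratic U)
    (hc : Continuous U) (t : ℝ) : 0 < tiltedMoment U 0 t := by
  simpa [tiltedMoment] using integral_exp_pos (hU.integrable_exp hc t)

theorem SuperQuadratic.half {U : ℝ → ℝ} (hU : SuperQuadratic U) :
    SuperQuadratic fun x => U x / 2 := fun A => by
  obtain ⟨C, hC⟩ := hU (2 * A)
  exact ⟨C / 2, fun x => by linarith [hC x]⟩

theorem SuperQuadratic.integrable_self_mul_exp {U : ℝ → ℝ} (hU : SuperQuadratic U)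
    (hc : Continuous U) (t : ℝ) : Integrable fun x => U x * exp (t * x - U x) := by
  obtain ⟨C, hC⟩ := hU.bddBelow
  refine ((hU.half.integrable_exp (by fun_prop) t).const_mul
    (2 * exp (C / 2) + 2 * |C| * exp (C / 2))).mono' (by fun_prop) (.of_forall fun x => ?_)
  have e : exp (t * x - U x) = exp (-U x / 2) * exp (t * x - U x / 2) := by
    rw [← exp_add]; ring_nf
  rw [norm_mul, norm_of_nonneg (exp_pos _).le, e, ← mul_assoc]
  refine mul_le_mul_of_nonneg_right ?_ (exp_pos _).le
  have h1 : |U x| ≤ |U x + C| + |C| := by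
    calc |U x| = |U x + C - C| := by ring_nf
      _ ≤ _ := abs_sub _ _
  have h2 : |U x + C| ≤ 2 * exp ((U x + C) / 2) := by
    rw [abs_of_nonneg (by linarith [hC x])]
    linarith [add_one_le_exp ((U x + C) / 2)]
  have h3 : 1 ≤ exp ((U x + C) / 2) := one_le_exp (by linarith [hC x])
  have e2 : exp ((U x + C) / 2) * exp (-U x / 2) = exp (C / 2) := by
    rw [← exp_add]; ring_nf
  calc ‖U x‖ * exp (-U x / 2)
      ≤ (2 * exp ((U x + C) / 2) + 2 * |C| * exp ((U x + C) / 2)) * exp (-U x / 2) := by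
        refine mul_le_mul_of_nonneg_right ?_ (exp_pos _).le
        rw [norm_eq_abs]
        nlinarith [abs_nonneg C]
    _ = _ := by rw [← e2]; ring

theorem SuperQuadratic.log_gibbsDensity {U : ℝ → ℝ} (hU : SuperQuadratic U)
    (hc : Continuous U) (t x : ℝ) :
    log (gibbsDensity U t x) = t * x - U x - log (tiltedMoment U 0 t) := by
  rw [gibbsDensity, log_div (exp_pos _).ne' (hU.tiltedMoment_zero_pos hc t).ne', log_exp]

theorem SuperQuadratic.admissibleDensity_gibbsDensity {U : ℝ → ℝ} (hU : SuperQuadratic U)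
    (hc : Continuous U) (t : ℝ) : AdmissibleDensity1 U (gibbsDensity U t) := by
  have hZ := hU.tiltedMoment_zero_pos hc t
  have i0 := (hU.integrable_pow_mul_exp hc 0 t).div_const (tiltedMoment U 0 t)
  have i1 := (hU.integrable_pow_mul_exp hc 1 t).div_const (tiltedMoment U 0 t)
  have i2 := (hU.integrable_pow_mul_exp hc 2 t).div_const (tiltedMoment U 0 t)
  have iU := (hU.integrable_self_mul_exp hc t).div_const (tiltedMoment U 0 t)
  refine ⟨?_, fun x => div_nonneg (exp_pos _).le hZ.le, ?_, ?_, ?_, ?_⟩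
  · have := hc.measurable
    unfold gibbsDensity
    fun_prop
  · simp only [gibbsDensity]
    rw [integral_div, div_eq_one_iff_eq hZ.ne']
    simp [tiltedMoment]
  · exact i2.congr (.of_forall fun x => by simp only [gibbsDensity]; ring)
  · refine (((i1.const_mul t).sub iU).sub (i0.const_mul (log (tiltedMoment U 0 t)))).congr
      (.of_forall fun x => ?_)
    dsimp only [Pi.sub_apply]
    rw [hU.log_gibbsDensity hc, gibbsDensity]
    ring
  · exact iU.congr (.of_forall fun x => by simp only [gibbsDensity]; ring)

theorem densMean1_gibbsDensity (U : ℝ → ℝ) (t : ℝ) :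
    densMean1 (gibbsDensity U t) = gibbsMean U t := by
  rw [densMean1, gibbsMean, tiltedMoment, ← integral_div]
  congr 1 with x
  simp only [gibbsDensity]
  ring

theorem AdmissibleDensity1.integrable {U ρ : ℝ → ℝ} (hρ : AdmissibleDensity1 U ρ) :
    Integrable ρ := by
  by_contra hn
  simpa [integral_undef hn] using hρ.total

theorem AdmissibleDensity1.integrable_mul_id {U ρ : ℝ → ℝ} (hρ : AdmissibleDensity1 U ρ) :
    Integrable fun x => ρ x * x := by
  refine (hρ.integrable.add hρ.mom2).mono' (hρ.meas.mul measurable_id).aestronglyMeasurable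
    (.of_forall fun x => ?_)
  rw [norm_mul, norm_of_nonneg (hρ.nonneg x), norm_eq_abs, Pi.add_apply]
  have : |x| ≤ 1 + x ^ 2 := by nlinarith [sq_abs x, sq_nonneg (|x| - 1), abs_nonneg x]
  nlinarith [hρ.nonneg x]

/-- The free energy split into its linear part, its interaction part and its entropy. -/
theorem AdmissibleDensity1.freeEnergy1_eq {U ρ : ℝ → ℝ} (hρ : AdmissibleDensity1 U ρ)
    (h : ℝ → ℝ) (θ : ℝ) : freeEnergy1 U h θ ρ =
      (∫ x, ρ x * U x) - θ * densMean1 ρ + h (densMean1 ρ) + ∫ x, ρ x * log (ρ x) := by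
  rw [freeEnergy1]
  congr 2
  rw [densMean1, ← integral_const_mul, ← integral_sub hρ.energy (hρ.integrable_mul_id.const_mul _)]
  congr 1 with x
  ring

/-- The Gibbs variational inequality. -/
theorem SuperQuadratic.neg_log_le {U ρ : ℝ → ℝ} (hU : SuperQuadratic U) (hc : Continuous U)
    (hρ : AdmissibleDensity1 U ρ) (t : ℝ) : -log (tiltedMoment U 0 t) ≤
      (∫ x, ρ x * U x) - t * densMean1 ρ + ∫ x, ρ x * log (ρ x) := by
  have hq := hU.admissibleDensity_gibbsDensity hc t
  have i1 : Integrable fun x => ρ x * log (ρ x) + ρ x * U x := hρ.ent.add hρ.energy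
  have i2 : Integrable fun x => ρ x * log (ρ x) + ρ x * U x - t * (ρ x * x) :=
    i1.sub (hρ.integrable_mul_id.const_mul t)
  have key : ∫ x, (ρ x - gibbsDensity U t x) ≤ ∫ x, (ρ x * log (ρ x) + ρ x * U x
      - t * (ρ x * x) + log (tiltedMoment U 0 t) * ρ x) := by
    refine integral_mono (hρ.integrable.sub hq.integrable)
      (i2.add (hρ.integrable.const_mul _)) fun x => ?_
    have hl := hU.log_gibbsDensity hc t x
    have hqpos : 0 < gibbsDensity U t x := div_pos (exp_pos _) (hU.tiltedMoment_zero_pos hc t)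
    rcases (hρ.nonneg x).eq_or_lt with h0 | h0
    · simp [← h0, hqpos.le]
    · have h1 := log_le_sub_one_of_pos (div_pos hqpos h0)
      rw [log_div hqpos.ne' h0.ne', hl] at h1
      have h2 := mul_le_mul_of_nonneg_left h1 h0.le
      have h3 : ρ x * (gibbsDensity U t x / ρ x - 1) = gibbsDensity U t x - ρ x := by
        field_simp
      dsimp only
      linarith
  rw [integral_sub hρ.integrable hq.integrable, hρ.total, hq.total,
    integral_add i2 (hρ.integrable.const_mul _),
    integral_sub i1 (hρ.integrable_mul_id.const_mul t),
    integral_add hρ.ent hρ.energy, integral_const_mul, integral_const_mul, hρ.total] at key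
  rw [densMean1]
  linarith

/-- The Gibbs density attains equality in the Gibbs variational inequality. -/
theorem SuperQuadratic.gibbs_energy_eq {U : ℝ → ℝ} (hU : SuperQuadratic U) (hc : Continuous U)
    (t : ℝ) : (∫ x, gibbsDensity U t x * U x) +
      ∫ x, gibbsDensity U t x * log (gibbsDensity U t x) =
      t * gibbsMean U t - log (tiltedMoment U 0 t) := by
  have hq := hU.admissibleDensity_gibbsDensity hc t
  rw [← integral_add hq.energy hq.ent, ← densMean1_gibbsDensity, densMean1,
    ← integral_const_mul]
  have : log (tiltedMoment U 0 t) = ∫ x, log (tiltedMoment U 0 t) * gibbsDensity U t x := by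
    rw [integral_const_mul, hq.total, mul_one]
  conv_rhs => rw [this]
  rw [← integral_sub (hq.integrable_mul_id.const_mul _) (hq.integrable.const_mul _)]
  congr 1 with x
  rw [hU.log_gibbsDensity hc]
  ring

/-- The mean is a subgradient of the log-partition function. -/
theorem SuperQuadratic.subgradient {U : ℝ → ℝ} (hU : SuperQuadratic U) (hc : Continuous U)
    (t s : ℝ) : gibbsMean U t * (s - t) ≤
      log (tiltedMoment U 0 s) - log (tiltedMoment U 0 t) := by
  have h1 := hU.neg_log_le hc (hU.admissibleDensity_gibbsDensity hc t) s
  have h2 := hU.gibbs_energy_eq hc t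
  rw [densMean1_gibbsDensity] at h1
  linarith

theorem SuperQuadratic.hasDerivAt_gibbsMean {U : ℝ → ℝ} (hU : SuperQuadratic U)
    (hc : Continuous U) (t : ℝ) : HasDerivAt (gibbsMean U)
      ((tiltedMoment U 2 t * tiltedMoment U 0 t - tiltedMoment U 1 t * tiltedMoment U 1 t) /
        tiltedMoment U 0 t ^ 2) t :=
  (hU.hasDerivAt_tiltedMoment hc 1 t).div (hU.hasDerivAt_tiltedMoment hc 0 t)
    (hU.tiltedMoment_zero_pos hc t).ne'

/-- The variance is at most the second moment about any centre. -/
theorem SuperQuadratic.deriv_gibbsMean_le {U : ℝ → ℝ} (hU : SuperQuadratic U)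
    (hc : Continuous U) (t c : ℝ) : deriv (gibbsMean U) t ≤
      (∫ x, (x - c) ^ 2 * exp (t * x - U x)) / tiltedMoment U 0 t := by
  have hZ := hU.tiltedMoment_zero_pos hc t
  have e : ∫ x, (x - c) ^ 2 * exp (t * x - U x) = tiltedMoment U 2 t
      - 2 * c * tiltedMoment U 1 t + c ^ 2 * tiltedMoment U 0 t := by
    simp only [tiltedMoment, ← integral_const_mul]
    have i1 : Integrable fun x => x ^ 2 * exp (t * x - U x)
        - 2 * c * (x ^ 1 * exp (t * x - U x)) := (hU.integrable_pow_mul_exp hc 2 t).sub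
      ((hU.integrable_pow_mul_exp hc 1 t).const_mul _)
    rw [← integral_sub (hU.integrable_pow_mul_exp hc 2 t)
      ((hU.integrable_pow_mul_exp hc 1 t).const_mul _),
      ← integral_add i1 ((hU.integrable_pow_mul_exp hc 0 t).const_mul _)]
    congr 1 with x
    ring
  rw [(hU.hasDerivAt_gibbsMean hc t).deriv, e, div_le_div_iff₀ (by positivity) hZ]
  nlinarith [mul_nonneg hZ.le (sq_nonneg (tiltedMoment U 1 t - c * tiltedMoment U 0 t))]

theorem integrable_sq_mul_gaussian {l : ℝ} (hl : 0 < l) :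
    Integrable fun x : ℝ => x ^ 2 * exp (-(l / 2) * x ^ 2) := by
  simpa using integrable_rpow_mul_exp_neg_mul_sq (half_pos hl) (s := 2) (by norm_num)

theorem integral_Ioi_sq_sub_inv_mul_gaussian {l : ℝ} (hl : 0 < l) :
    ∫ x in Ioi (0 : ℝ), (x ^ 2 - 1 / l) * exp (-(l / 2) * x ^ 2) = 0 := by
  have hint : Integrable fun x : ℝ => (x ^ 2 - 1 / l) * exp (-(l / 2) * x ^ 2) :=
    ((integrable_sq_mul_gaussian hl).sub
      ((integrable_exp_neg_mul_sq (half_pos hl)).const_mul (1 / l))).congr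
      (.of_forall fun x => by simp only [Pi.sub_apply]; ring)
  have hF : Integrable fun x : ℝ => -(1 / l) * (x * exp (-(l / 2) * x ^ 2)) :=
    (integrable_mul_exp_neg_mul_sq (half_pos hl)).const_mul _
  have hd : ∀ x : ℝ, HasDerivAt (fun x : ℝ => -(1 / l) * (x * exp (-(l / 2) * x ^ 2)))
      ((x ^ 2 - 1 / l) * exp (-(l / 2) * x ^ 2)) x := fun x => by
    have h := ((hasDerivAt_id x).mul
      (((hasDerivAt_pow 2 x).const_mul (-(l / 2))).exp)).const_mul (-(1 / l))
    convert! h using 1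
    simp only [id]
    field_simp
    ring
  have ht := tendsto_zero_of_hasDerivAt_of_integrableOn_Ioi (a := 0) (fun x _ => hd x)
    hint.integrableOn hF.integrableOn
  have := integral_Ioi_of_hasDerivAt_of_tendsto' (a := 0) (fun x _ => hd x) hint.integrableOn ht
  simpa using this

/-- Among antitone weights on the half-line, the Gaussian second moment is largest for the
constant weight. -/
theorem setIntegral_sq_mul_gaussian_le {l : ℝ} (hl : 0 < l) {w : ℝ → ℝ}
    (hw : AntitoneOn w (Ici 0))
    (h0 : IntegrableOn (fun x => w x * exp (-(l / 2) * x ^ 2)) (Ioi 0))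
    (h2 : IntegrableOn (fun x => x ^ 2 * (w x * exp (-(l / 2) * x ^ 2))) (Ioi 0)) :
    ∫ x in Ioi (0 : ℝ), x ^ 2 * (w x * exp (-(l / 2) * x ^ 2)) ≤
      1 / l * ∫ x in Ioi (0 : ℝ), w x * exp (-(l / 2) * x ^ 2) := by
  have ha : 0 < 1 / √l := by positivity
  have ha2 : (1 / √l) ^ 2 = 1 / l := by rw [div_pow, sq_sqrt hl.le, one_pow]
  have hint : Integrable fun x : ℝ => (x ^ 2 - 1 / l) * exp (-(l / 2) * x ^ 2) :=
    ((integrable_sq_mul_gaussian hl).sub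
      ((integrable_exp_neg_mul_sq (half_pos hl)).const_mul (1 / l))).congr
      (.of_forall fun x => by simp only [Pi.sub_apply]; ring)
  rw [← sub_nonpos, ← integral_const_mul, ← integral_sub h2 (h0.const_mul _)]
  calc _ ≤ ∫ x in Ioi (0 : ℝ), w (1 / √l) * ((x ^ 2 - 1 / l) * exp (-(l / 2) * x ^ 2)) := by
        refine setIntegral_mono_on (h2.sub (h0.const_mul _)) (hint.integrableOn.const_mul _)
          measurableSet_Ioi fun x hx => ?_
        have hx : 0 < x := hx
        have key : (x ^ 2 - 1 / l) * (w x - w (1 / √l)) ≤ 0 := by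
          rw [← ha2]
          rcases le_total x (1 / √l) with h | h
          · exact mul_nonpos_of_nonpos_of_nonneg (by nlinarith)
              (sub_nonneg.2 (hw hx.le ha.le h))
          · exact mul_nonpos_of_nonneg_of_nonpos (by nlinarith)
              (sub_nonpos.2 (hw ha.le hx.le h))
        nlinarith [mul_nonneg_of_nonpos_of_nonpos key
          (neg_nonpos.2 (exp_pos (-(l / 2) * x ^ 2)).le)]
    _ = 0 := by rw [integral_const_mul, integral_Ioi_sq_sub_inv_mul_gaussian hl, mul_zero]

theorem integral_sq_mul_gaussian_le {l : ℝ} (hl : 0 < l) {w : ℝ → ℝ}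
    (hw : AntitoneOn w (Ici 0)) (hw' : MonotoneOn w (Iic 0))
    (h0 : Integrable (fun x => w x * exp (-(l / 2) * x ^ 2)))
    (h2 : Integrable (fun x => x ^ 2 * (w x * exp (-(l / 2) * x ^ 2)))) :
    ∫ x, x ^ 2 * (w x * exp (-(l / 2) * x ^ 2)) ≤
      1 / l * ∫ x, w x * exp (-(l / 2) * x ^ 2) := by
  have hneg : AntitoneOn (fun x => w (-x)) (Ici 0) := fun x hx y hy hxy =>
    hw' (by simpa using hy) (by simpa using hx) (neg_le_neg hxy)
  have p := setIntegral_sq_mul_gaussian_le hl hw h0.integrableOn h2.integrableOn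
  have n := setIntegral_sq_mul_gaussian_le hl hneg
    (by simpa using h0.comp_neg.integrableOn) (by simpa using h2.comp_neg.integrableOn)
  have e0 := integral_comp_neg_Ioi 0 (fun x => w x * exp (-(l / 2) * x ^ 2))
  have e2 := integral_comp_neg_Ioi 0 (fun x => x ^ 2 * (w x * exp (-(l / 2) * x ^ 2)))
  simp only [neg_sq, neg_zero] at e0 e2
  rw [e0, e2] at n
  rw [← intervalIntegral.integral_Iic_add_Ioi (b := 0) h0.integrableOn h0.integrableOn,
    ← intervalIntegral.integral_Iic_add_Ioi (b := 0) h2.integrableOn h2.integrableOn]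
  linarith

/-- Removing the quadratic part of a strongly convex function keeps its minimizer. -/
theorem ConvexOn.le_of_sub_sq {P : ℝ → ℝ} {l c : ℝ} (hl : 0 < l)
    (hN : ConvexOn ℝ univ fun x => P x - l / 2 * (x - c) ^ 2) (hc : ∀ x, P c ≤ P x) (x : ℝ) :
    P c ≤ P x - l / 2 * (x - c) ^ 2 := by
  by_contra! hlt
  set δ := P c - (P x - l / 2 * (x - c) ^ 2) with hδ
  have hδ0 : 0 < δ := by linarith
  have hD : 0 < δ + l * (x - c) ^ 2 := by positivity
  set s := δ / (δ + l * (x - c) ^ 2) with hs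
  have hs0 : 0 < s := by positivity
  have hs1 : s ≤ 1 := (div_le_one hD).2 (by nlinarith [mul_nonneg hl.le (sq_nonneg (x - c))])
  have h := hN.2 (mem_univ c) (mem_univ x) (sub_nonneg.2 hs1) hs0.le (by ring)
  simp only [smul_eq_mul] at h
  have h' := hc ((1 - s) * c + s * x)
  have e : (1 - s) * c + s * x - c = s * (x - c) := by ring
  rw [e] at h
  have h3 : s * δ ≤ l / 2 * (s * (x - c)) ^ 2 := by rw [hδ]; nlinarith
  have h4 : δ ≤ l / 2 * s * (x - c) ^ 2 := by
    refine le_of_mul_le_mul_left ?_ hs0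
    calc _ ≤ _ := h3
      _ = _ := by ring
  have h5 : s * (δ + l * (x - c) ^ 2) = δ := div_mul_cancel₀ _ hD.ne'
  nlinarith [mul_pos hs0 hδ0]

theorem SuperQuadratic.tendsto_cocompact {U : ℝ → ℝ} (hU : SuperQuadratic U) (t : ℝ) :
    Tendsto (fun x => U x - t * x) (cocompact ℝ) atTop := by
  obtain ⟨C, hC⟩ := hU 2
  have h : Tendsto (fun x : ℝ => ‖x‖ ^ 2 + (-C - t ^ 2)) (cocompact ℝ) atTop :=
    tendsto_atTop_add_const_right _ _
      ((tendsto_pow_atTop two_ne_zero).comp (tendsto_norm_cocompact_atTop (E := ℝ)))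
  refine tendsto_atTop_mono (fun x => ?_) h
  rw [norm_eq_abs, sq_abs]
  nlinarith [hC x, sq_nonneg (x - t / 2), sq_nonneg t]

/-- The second moment of a bounded perturbation of a strongly log-concave density about a
suitable centre is bounded uniformly in the tilt. -/
theorem SuperQuadratic.exists_integral_sub_sq_le {U Q : ℝ → ℝ} {l M : ℝ} (hU : SuperQuadratic U)
    (hc : Continuous U) (hl : 0 < l) (hQ : ConvexOn ℝ univ fun x => Q x - l / 2 * x ^ 2)
    (hB : ∀ x, |U x - Q x| ≤ M) (t : ℝ) : ∃ c, ∫ x, (x - c) ^ 2 * exp (t * x - U x) ≤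
      exp (2 * M) / l * tiltedMoment U 0 t := by
  have hQc : Continuous Q := by
    have h : Continuous fun x => Q x - l / 2 * x ^ 2 :=
      continuousOn_univ.1 (hQ.continuousOn isOpen_univ)
    convert h.add (by fun_prop : Continuous fun x : ℝ => l / 2 * x ^ 2) using 1
    ext x
    simp
  have hQs : SuperQuadratic Q := fun A => by
    obtain ⟨C, hC⟩ := hU A
    exact ⟨C + M, fun x => by linarith [hC x, (abs_le.1 (hB x)).2]⟩
  obtain ⟨c, hmin⟩ := Continuous.exists_forall_le
    (by fun_prop : Continuous fun x => Q x - t * x) (hQs.tendsto_cocompact t)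
  refine ⟨c, ?_⟩
  set N : ℝ → ℝ := fun x => Q x - t * x - l / 2 * (x - c) ^ 2 with hNdef
  have hN : ConvexOn ℝ univ N := by
    have hlin : ConvexOn ℝ univ fun x : ℝ => (l * c - t) * x + -(l / 2 * c ^ 2) :=
      ((LinearMap.mul ℝ ℝ (l * c - t)).convexOn convex_univ).add_const _
    convert! hQ.add hlin using 1
    ext x
    simp only [hNdef, Pi.add_apply]
    ring
  have hNmin : ∀ x, N c ≤ N x := fun x => by
    simpa [hNdef] using ConvexOn.le_of_sub_sq hl hN hmin x
  have eN : ∀ x, exp (-N (x + c)) * exp (-(l / 2) * x ^ 2) = exp (t * (x + c) - Q (x + c)) :=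
    fun x => by
      rw [← exp_add, hNdef]
      ring_nf
  have i0 := (hQs.integrable_exp hQc t)
  have i2 : Integrable fun x => (x - c) ^ 2 * exp (t * x - Q x) :=
    ((hQs.integrable_pow_mul_exp hQc 2 t).sub
      (((hQs.integrable_pow_mul_exp hQc 1 t).const_mul (2 * c)).sub
        ((hQs.integrable_pow_mul_exp hQc 0 t).const_mul (c ^ 2)))).congr
      (.of_forall fun x => by simp only [Pi.sub_apply]; ring)
  have i2U : Integrable fun x => (x - c) ^ 2 * exp (t * x - U x) :=
    ((hU.integrable_pow_mul_exp hc 2 t).sub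
      (((hU.integrable_pow_mul_exp hc 1 t).const_mul (2 * c)).sub
        ((hU.integrable_pow_mul_exp hc 0 t).const_mul (c ^ 2)))).congr
      (.of_forall fun x => by simp only [Pi.sub_apply]; ring)
  have key := integral_sq_mul_gaussian_le hl (w := fun x => exp (-N (x + c)))
    (fun x hx y hy hxy => exp_le_exp.2 (neg_le_neg ((hN.le_max_of_mem_Icc (mem_univ c)
      (mem_univ (y + c)) ⟨by simpa using hx, by simpa using hxy⟩).trans
        (max_le (hNmin _) le_rfl))))
    (fun x hx y hy hxy => exp_le_exp.2 (neg_le_neg ((hN.le_max_of_mem_Icc (mem_univ (x + c))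
      (mem_univ c) ⟨by simpa using hxy, by simpa using hy⟩).trans
        (max_le le_rfl (hNmin _)))))
    (by simpa only [eN] using i0.comp_add_right c)
    (by simpa only [eN, add_sub_cancel_right] using i2.comp_add_right c)
  simp only [eN] at key
  rw [integral_add_right_eq_self (fun x => exp (t * x - Q x)) c] at key
  have es := integral_add_right_eq_self (μ := volume)
    (fun x => (x - c) ^ 2 * exp (t * x - Q x)) c
  simp only [add_sub_cancel_right] at es
  rw [es] at key
  have hup : ∀ x, exp (t * x - U x) ≤ exp M * exp (t * x - Q x) := fun x => by
    rw [← exp_add]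
    exact exp_le_exp.2 (by linarith [(abs_le.1 (hB x)).1])
  have hlow : ∀ x, exp (t * x - Q x) ≤ exp M * exp (t * x - U x) := fun x => by
    rw [← exp_add]
    exact exp_le_exp.2 (by linarith [(abs_le.1 (hB x)).2])
  calc ∫ x, (x - c) ^ 2 * exp (t * x - U x)
      ≤ ∫ x, exp M * ((x - c) ^ 2 * exp (t * x - Q x)) :=
        integral_mono i2U (i2.const_mul _) fun x => by
          dsimp only
          nlinarith [mul_le_mul_of_nonneg_left (hup x) (sq_nonneg (x - c))]
    _ = exp M * ∫ x, (x - c) ^ 2 * exp (t * x - Q x) := integral_const_mul _ _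
    _ ≤ exp M * (1 / l * ∫ x, exp (t * x - Q x)) := by gcongr
    _ ≤ exp M * (1 / l * ∫ x, exp M * exp (t * x - U x)) := by
        have := integral_mono i0 ((hU.integrable_exp hc t).const_mul (exp M)) hlow
        gcongr
    _ = exp (2 * M) / l * tiltedMoment U 0 t := by
        rw [integral_const_mul, two_mul, exp_add, tiltedMoment]
        simp only [pow_zero, one_mul]
        ring

theorem SuperQuadratic.gibbsMean_sub_le {U Q : ℝ → ℝ} {l M : ℝ} (hU : SuperQuadratic U)
    (hc : Continuous U) (hl : 0 < l) (hQ : ConvexOn ℝ univ fun x => Q x - l / 2 * x ^ 2)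
    (hB : ∀ x, |U x - Q x| ≤ M) {s t : ℝ} (hst : s ≤ t) :
    gibbsMean U t - gibbsMean U s ≤ exp (2 * M) / l * (t - s) := by
  refine image_sub_le_mul_sub_of_deriv_le
    (fun u => (hU.hasDerivAt_gibbsMean hc u).differentiableAt) (fun u => ?_) hst
  obtain ⟨c, h⟩ := hU.exists_integral_sub_sq_le hc hl hQ hB u
  exact (hU.deriv_gibbsMean_le hc u c).trans
    ((div_le_iff₀ (hU.tiltedMoment_zero_pos hc u)).2 h)

/-- The mean grows sublinearly in the tilt. -/
theorem SuperQuadratic.exists_mul_gibbsMean_le {U : ℝ → ℝ} (hU : SuperQuadratic U)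
    (hc : Continuous U) {b : ℝ} (hb : 0 < b) :
    ∃ T, ∀ t, T ≤ |t| → t * gibbsMean U t ≤ b * t ^ 2 := by
  obtain ⟨C, hC⟩ := hU (1 + 2 / b)
  have hG : 0 < ∫ x : ℝ, exp (-1 * x ^ 2) := integral_exp_pos (integrable_exp_neg_mul_sq one_pos)
  have hup : ∀ t, log (tiltedMoment U 0 (2 * t)) ≤
      b / 2 * t ^ 2 + C + log (∫ x : ℝ, exp (-1 * x ^ 2)) := fun t => by
    rw [← log_exp (b / 2 * t ^ 2 + C), ← log_mul (exp_pos _).ne' hG.ne', ← integral_const_mul]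
    refine log_le_log (hU.tiltedMoment_zero_pos hc _) ?_
    simp only [tiltedMoment, pow_zero, one_mul]
    refine integral_mono (hU.integrable_exp hc _)
      ((integrable_exp_neg_mul_sq one_pos).const_mul _) fun x => ?_
    dsimp only
    rw [← exp_add]
    refine exp_le_exp.2 ?_
    have h1 : 2 * t * x ≤ b / 2 * t ^ 2 + 2 / b * x ^ 2 := by
      have : b / 2 * t ^ 2 + 2 / b * x ^ 2 - 2 * t * x = (b * t - 2 * x) ^ 2 / (2 * b) := by
        field_simp
        ring
      have : 0 ≤ (b * t - 2 * x) ^ 2 / (2 * b) := by positivity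
      linarith
    nlinarith [hC x]
  set K := C + log (∫ x : ℝ, exp (-1 * x ^ 2)) - log (tiltedMoment U 0 0) with hK
  refine ⟨max 1 (2 * (|K| + |gibbsMean U 0|) / b), fun t ht => ?_⟩
  have h1 : 1 ≤ |t| := (le_max_left _ _).trans ht
  have h2 := (div_le_iff₀ hb).1 ((le_max_right _ _).trans ht)
  have h3 := hU.subgradient hc t (2 * t)
  have h4 := hU.subgradient hc 0 t
  have h5 := hup t
  have h6 : -gibbsMean U 0 * t ≤ |gibbsMean U 0| * |t| := by
    rw [← abs_mul, neg_mul]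
    exact neg_le_abs _
  have h7 := le_abs_self K
  have h8 : |K| ≤ |K| * |t| := le_mul_of_one_le_right (abs_nonneg _) h1
  have h9 := mul_le_mul_of_nonneg_right h2 (abs_nonneg t)
  have h10 : |t| * b * |t| = b * t ^ 2 := by rw [← sq_abs t]; ring
  nlinarith

/-- A function with a continuous subgradient selection is differentiable. -/
theorem hasDerivAt_of_subgradient {F p : ℝ → ℝ} {x : ℝ} (hp : ContinuousAt p x)
    (h : ∀ x y, p x * (y - x) ≤ F y - F x) : HasDerivAt F (p x) x := by
  rw [hasDerivAt_iff_isLittleO, Asymptotics.isLittleO_iff]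
  intro c hc
  filter_upwards [Metric.continuousAt_iff'.1 hp c hc] with y hy
  rw [dist_eq] at hy
  have h1 := h x y
  have h2 := h y x
  rw [smul_eq_mul, norm_of_nonneg (by linarith), norm_eq_abs]
  calc F y - F x - (y - x) * p x ≤ (p y - p x) * (y - x) := by linarith
    _ ≤ |p y - p x| * |y - x| := by rw [← abs_mul]; exact le_abs_self _
    _ ≤ c * |y - x| := by gcongr

theorem Monotone.mul_sub_le_of_hasDerivAt {F p : ℝ → ℝ} (hp : Monotone p)
    (hF : ∀ x, HasDerivAt F (p x) x) (x y : ℝ) : p x * (y - x) ≤ F y - F x := by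
  have hc : Continuous F := continuous_iff_continuousAt.2 fun x => (hF x).continuousAt
  rcases lt_trichotomy x y with hxy | rfl | hxy
  · obtain ⟨c, hcm, e⟩ := exists_hasDerivAt_eq_slope F p hxy hc.continuousOn fun z _ => hF z
    rw [eq_div_iff (sub_pos.2 hxy).ne'] at e
    rw [← e]
    exact mul_le_mul_of_nonneg_right (hp hcm.1.le) (sub_pos.2 hxy).le
  · simp
  · obtain ⟨c, hcm, e⟩ := exists_hasDerivAt_eq_slope F p hxy hc.continuousOn fun z _ => hF z
    rw [eq_div_iff (sub_pos.2 hxy).ne'] at e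
    nlinarith [hp hcm.2.le]

/-- Envelope theorem for the modified free energy. -/
theorem SuperQuadratic.hasDerivAt_wFun1 {U : ℝ → ℝ} (hU : SuperQuadratic U) (hc : Continuous U)
    {ginv r rinv h : ℝ → ℝ} (m₀ κ : ℝ) (hg : StrictMono (gibbsMean U))
    (hginvL : Function.LeftInverse ginv (gibbsMean U))
    (hginvR : Function.RightInverse ginv (gibbsMean U))
    (hr : StrictMono r) (hrc : Continuous r)
    (hrinvL : Function.LeftInverse rinv r) (hrinvR : Function.RightInverse rinv r)
    (hh : ∀ y, h y = ∫ u in m₀..y, (rinv (ginv u) - ginv u)) (θ : ℝ) :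
    HasDerivAt (wFun1 U h κ) (θ / κ - gibbsMean U (r θ)) θ := by
  have hginv_mono : Monotone ginv := fun u v huv =>
    hg.le_iff_le.1 (by rwa [hginvR u, hginvR v])
  have hrinv_mono : Monotone rinv := fun u v huv =>
    hr.le_iff_le.1 (by rwa [hrinvR u, hrinvR v])
  have hginv_cont : Continuous ginv := hginv_mono.continuous_of_surjective hginvL.surjective
  have hrinv_cont : Continuous rinv := hrinv_mono.continuous_of_surjective hrinvL.surjective
  set φ : ℝ → ℝ := fun t => log (tiltedMoment U 0 t) with hφ
  have hconj : ∀ m, HasDerivAt (fun m => m * ginv m - φ (ginv m)) (ginv m) m := fun m => by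
    refine hasDerivAt_of_subgradient hginv_cont.continuousAt fun x y => ?_
    have := hU.subgradient hc (ginv y) (ginv x)
    rw [hginvR y] at this
    linarith
  have hhd : ∀ m, HasDerivAt h (rinv (ginv m) - ginv m) m := fun m => by
    rw [funext hh]
    exact (Continuous.integral_hasStrictDerivAt (by fun_prop) m₀ m).hasDerivAt
  set J : ℝ → ℝ := fun m => m * ginv m - φ (ginv m) + h m with hJ
  have hJd : ∀ m, HasDerivAt J (rinv (ginv m)) m := fun m =>
    ((hconj m).add (hhd m)).congr_deriv (by ring)
  have hJle := Monotone.mul_sub_le_of_hasDerivAt (hrinv_mono.comp hginv_mono) hJd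
  have hmin : ∀ θ m, J (gibbsMean U (r θ)) - θ * gibbsMean U (r θ) ≤ J m - θ * m := fun θ m => by
    have := hJle (gibbsMean U (r θ)) m
    simp only [Function.comp_apply] at this
    rw [hginvL, hrinvL] at this
    linarith
  set W : ℝ → ℝ := fun θ => J (gibbsMean U (r θ)) - θ * gibbsMean U (r θ) with hW
  have hInf : ∀ θ, sInf {s : ℝ | ∃ ρ, AdmissibleDensity1 U ρ ∧ s = freeEnergy1 U h θ ρ} = W θ := by
    intro θ
    refine IsLeast.csInf_eq ⟨⟨_, hU.admissibleDensity_gibbsDensity hc (r θ), ?_⟩, ?_⟩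
    · rw [(hU.admissibleDensity_gibbsDensity hc (r θ)).freeEnergy1_eq, densMean1_gibbsDensity]
      have := hU.gibbs_energy_eq hc (r θ)
      simp only [hW, hJ, hφ]
      rw [hginvL]
      linarith
    · rintro _ ⟨ρ, hρ, rfl⟩
      rw [hρ.freeEnergy1_eq]
      have h1 := hU.neg_log_le hc hρ (ginv (densMean1 ρ))
      have h2 := hmin θ (densMean1 ρ)
      simp only [hW]
      simp only [hJ, hφ] at h2 ⊢
      linarith
  have hWd : HasDerivAt (fun θ => -W θ) (gibbsMean U (r θ)) θ := by
    have hgc : Continuous (gibbsMean U) :=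
      continuous_iff_continuousAt.2 fun t => (hU.hasDerivAt_gibbsMean hc t).continuousAt
    refine hasDerivAt_of_subgradient (p := fun θ => gibbsMean U (r θ))
      (hgc.comp hrc).continuousAt fun x y => ?_
    have := hmin y (gibbsMean U (r x))
    simp only [hW]
    linarith
  have hw : wFun1 U h κ = fun θ => θ ^ 2 / (2 * κ) + W θ := by
    ext θ
    rw [wFun1, hInf]
  rw [hw]
  have := ((hasDerivAt_pow 2 θ).div_const (2 * κ)).sub hWd
  convert! this using 1
  · ext θ
    simp
  · congr 1
    simp only [Nat.cast_ofNat, Nat.add_one_sub_one, pow_one]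
    exact (mul_div_mul_left θ κ two_ne_zero).symm

/-- A continuous function vanishing only at `c`, with positive slope at `c`, the sign of `x - c`
elsewhere and linear growth at infinity, is coercive around `c`. -/
theorem exists_coercive {q : ℝ → ℝ} {q' c η₀ : ℝ} (hq : Continuous q) (hqc : q c = 0)
    (hd : HasDerivAt q q' c) (hq' : 0 < q') (hpos : ∀ x, x ≠ c → 0 < (x - c) * q x)
    (hη₀ : 0 < η₀) (hinf : ∀ᶠ x in cocompact ℝ, η₀ * (x - c) ^ 2 ≤ (x - c) * q x) :
    ∃ η, 0 < η ∧ ∀ x, η * (x - c) ^ 2 ≤ (x - c) * q x := by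
  have heq : ∀ x, (x - c) * q x = dslope q c x * (x - c) ^ 2 := fun x => by
    have := sub_smul_dslope q c x
    rw [smul_eq_mul, hqc, sub_zero] at this
    rw [← this]
    ring
  have hcont : Continuous (dslope q c) := continuous_iff_continuousAt.2 fun x => by
    rcases eq_or_ne x c with rfl | hx
    · exact continuousAt_dslope_same.2 hd.differentiableAt
    · exact (continuousAt_dslope_of_ne hx).2 hq.continuousAt
  have hdpos : ∀ x, 0 < dslope q c x := fun x => by
    rcases eq_or_ne x c with rfl | hx
    · rwa [dslope_same, hd.deriv]
    · have := hpos x hx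
      rw [heq] at this
      exact pos_of_mul_pos_left this (sq_nonneg _)
  have hinf' : ∀ᶠ x in cocompact ℝ, η₀ ≤ dslope q c x := by
    have hne : ∀ᶠ x in cocompact ℝ, x ≠ c :=
      (isCompact_singleton (x := c)).compl_mem_cocompact
    filter_upwards [hinf, hne] with x hx hxc
    rw [heq] at hx
    exact le_of_mul_le_mul_right hx (by have := sub_ne_zero.2 hxc; positivity)
  obtain ⟨x₀, hx₀⟩ := Continuous.exists_forall_le' (f := fun x => min (dslope q c x) η₀)
    (by fun_prop) c (hinf'.mono fun x hx => by simp [hx])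
  refine ⟨min (dslope q c x₀) η₀, lt_min (hdpos _) hη₀, fun x => ?_⟩
  rw [heq]
  exact mul_le_mul_of_nonneg_right ((hx₀ x).trans (min_le_left _ _)) (sq_nonneg _)

theorem ContinuousOn.pos_of_ne_zero {s : Set ℝ} {D : ℝ → ℝ} (hD : ContinuousOn D s)
    (hs : s.OrdConnected) (hne : ∀ x ∈ s, D x ≠ 0) {x₀ : ℝ} (hx₀ : x₀ ∈ s) (h₀ : 0 < D x₀)
    {x : ℝ} (hx : x ∈ s) : 0 < D x := by
  by_contra! hle
  obtain ⟨y, hy, e⟩ := hs.isPreconnected.intermediate_value hx hx₀ hD ⟨hle, h₀.le⟩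
  exact hne y hy e

theorem superQuadratic_of_rpow_le {V : ℝ → ℝ} (hV : Differentiable ℝ V) {β R : ℝ} (hβ : 2 < β)
    (hgrow : ∀ x : ℝ, R ≤ |x| → |x| ^ β ≤ x * deriv V x) : SuperQuadratic V := fun A => by
  obtain ⟨R₁, hR₁⟩ := eventually_atTop.1
    ((tendsto_rpow_atTop (sub_pos.2 hβ)).eventually_ge_atTop (2 * A))
  set S := max (max R R₁) 1 with hS
  have hd : ∀ x, HasDerivAt (fun x => V x - A * x ^ 2) (deriv V x - A * (2 * x)) x := fun x =>
    ((hV x).hasDerivAt.sub ((hasDerivAt_pow 2 x).const_mul A)).congr_deriv (by simp)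
  have hsgn : ∀ x, S ≤ |x| → 0 ≤ x * (deriv V x - A * (2 * x)) := fun x hx => by
    have hx1 : R ≤ |x| := ((le_max_left _ _).trans (le_max_left _ _)).trans hx
    have hx2 : R₁ ≤ |x| := ((le_max_right _ _).trans (le_max_left _ _)).trans hx
    have hx3 : 0 < |x| := one_pos.trans_le ((le_max_right _ _).trans hx)
    have h1 := hgrow x hx1
    have h2 := mul_le_mul_of_nonneg_right (hR₁ _ hx2) (sq_nonneg |x|)
    rw [← rpow_natCast |x| 2, ← rpow_add hx3, rpow_natCast, sq_abs] at h2
    norm_num at h2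
    linarith
  have hE : Continuous fun x => V x - A * x ^ 2 := hV.continuous.sub (by fun_prop)
  have hS0 : 0 < S := one_pos.trans_le (le_max_right _ _)
  obtain ⟨x₀, -, hx₀⟩ := isCompact_Icc.exists_isMinOn (s := Icc (-S) S)
    ⟨0, by simpa using hS0.le⟩ hE.continuousOn
  have hIcc : ∀ x ∈ Icc (-S) S, V x₀ - A * x₀ ^ 2 ≤ V x - A * x ^ 2 := fun x hx => hx₀ hx
  refine ⟨-(V x₀ - A * x₀ ^ 2), fun x => ?_⟩
  suffices V x₀ - A * x₀ ^ 2 ≤ V x - A * x ^ 2 by linarith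
  rcases lt_or_ge x (-S) with hx | hx
  · have hanti : AntitoneOn (fun x => V x - A * x ^ 2) (Iic (-S)) := by
      refine antitoneOn_of_deriv_nonpos (convex_Iic _) hE.continuousOn
        (fun y _ => (hd y).differentiableAt.differentiableWithinAt) fun y hy => ?_
      rw [interior_Iic, mem_Iio] at hy
      rw [(hd y).deriv]
      have := hsgn y (by rw [abs_of_neg (by linarith)]; linarith)
      by_contra! hlt
      nlinarith
    exact (hIcc (-S) ⟨le_rfl, by linarith⟩).trans (hanti hx.le (mem_Iic.2 le_rfl) hx.le)
  rcases le_or_gt x S with hx' | hx'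
  · exact hIcc x ⟨hx, hx'⟩
  · have hmono : MonotoneOn (fun x => V x - A * x ^ 2) (Ici S) := by
      refine monotoneOn_of_deriv_nonneg (convex_Ici _) hE.continuousOn
        (fun y _ => (hd y).differentiableAt.differentiableWithinAt) fun y hy => ?_
      rw [interior_Ici, mem_Ioi] at hy
      rw [(hd y).deriv]
      have := hsgn y (by rw [abs_of_pos (by linarith)]; linarith)
      by_contra! hlt
      nlinarith
    exact (hIcc S ⟨by linarith, le_rfl⟩).trans (hmono (mem_Ici.2 le_rfl) hx'.le hx'.le)

theorem fFun_eq_gibbsMean {σ : ℝ} (hσ : 0 < σ) {V U : ℝ → ℝ}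
    (hU : ∀ x, U x = (V x + x ^ 2 / 2) / σ ^ 2) (m : ℝ) :
    fFun σ V m = gibbsMean U (1 / σ ^ 2 * m) := by
  have e : ∀ x, nuDens σ V m x =
      exp (-(1 / σ ^ 2 * m ^ 2 / 2)) * exp (1 / σ ^ 2 * m * x - U x) := fun x => by
    rw [nuDens, ← exp_add, hU]
    congr 1
    field_simp
    ring
  simp only [fFun, gibbsMean, tiltedMoment, e, mul_left_comm _ (exp (-(1 / σ ^ 2 * m ^ 2 / 2))),
    integral_const_mul, pow_one, pow_zero, one_mul]
  exact mul_div_mul_left _ _ (exp_pos _).ne'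

/-- **Proposition (properties of `w` for the modified energy, dimension 1).**
`w'(θ) = θ/κ − f(r(θ)/κ)`; `κ m*` is the unique critical point of `w`; `w` satisfies the
stated coercivity inequality; and `w''` is bounded below. -/
theorem w_modified_properties_dim1
    (σ : ℝ) (hσ : 0 < σ)
    -- confining potential V
    (V Vc Vb : ℝ → ℝ) (hV : ContDiff ℝ 2 V) (hdec : ∀ x, V x = Vc x + Vb x)
    (ρ₀ : ℝ) (hρ₀ : 0 < ρ₀) (hVc : StrongConvexOn Set.univ ρ₀ Vc)
    (Mb : ℝ) (hVb : ∀ x, |Vb x| ≤ Mb)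
    (β R_V θ₀ : ℝ) (hβ : 2 < β) (hRV : 0 < R_V) (hθ₀ : 0 < θ₀)
    (hgrow : ∀ x : ℝ, R_V ≤ |x| → x * deriv V x ≥ |x| ^ β ∧ |deriv V x| ≤ |x| ^ θ₀)
    (L : ℝ) (hL : 0 < L)
    (hOS : ∀ x y : ℝ, (deriv V x - deriv V y) * (x - y) ≥ -L * (x - y) ^ 2)
    -- f is an increasing bijection with inverse finv
    (hfmono : StrictMono (fFun σ V))
    (finv : ℝ → ℝ) (hfinvL : Function.LeftInverse finv (fFun σ V))
    (hfinvR : Function.RightInverse finv (fFun σ V))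
    -- κ = 1/σ²
    (κ : ℝ) (hκ : κ = 1 / σ ^ 2)
    -- fixed points m* and m₋, and the domain D = [a, ∞)
    (mstar a : ℝ) (ha : a < mstar)
    (hfixstar : fFun σ V mstar = mstar)
    (hf'pos : 0 < deriv (fFun σ V) mstar) (hf'lt : deriv (fFun σ V) mstar < 1)
    (huniqD : ∀ m, a ≤ m → fFun σ V m = m → m = mstar)
    (mminus : ℝ) (hmminus : mminus < a) (hfixminus : fFun σ V mminus = mminus)
    (hnofixbelow : ∀ m, m < mminus → fFun σ V m ≠ m)
    (ε : ℝ) (hε : 0 < ε) (hnofixnear : ∀ m, a - ε ≤ m → m ≤ a → fFun σ V m ≠ m)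
    (a' a'' : ℝ) (ha' : a' = κ * finv a) (ha'' : a'' = κ * finv (a - ε))
    -- the modification function r and its inverse
    (r : ℝ → ℝ) (hrC2 : ContDiff ℝ 2 r) (hrmono : StrictMono r)
    (hr1 : ∀ z, a' ≤ z → r z = z)
    (hr2 : a'' ≤ r (κ * mminus))
    (hr3 : ∀ z, z ≤ κ * mminus → r z = r (κ * mminus) + z - κ * mminus)
    (hr4 : ∀ z, 0 < deriv r z ∧ deriv r z ≤ 1)
    (rinv : ℝ → ℝ) (hrinvL : Function.LeftInverse rinv r)
    (hrinvR : Function.RightInverse rinv r)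
    -- the modified interaction energy h
    (h : ℝ → ℝ)
    (hhdef : ∀ y, h y = ∫ u in mstar..y, (rinv (κ * finv u) - κ * finv u))
    -- the effective single-particle potential
    (V₀ : ℝ → ℝ) (hV₀ : ∀ x, V₀ x = (V x + x ^ 2 / 2) / σ ^ 2) :
    (∀ θ : ℝ, HasDerivAt (wFun1 V₀ h κ) (θ / κ - fFun σ V (r θ / κ)) θ) ∧
    (∀ θ : ℝ, deriv (wFun1 V₀ h κ) θ = 0 ↔ θ = κ * mstar) ∧
    (∃ η : ℝ, 0 < η ∧ ∀ θ : ℝ,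
      (θ - κ * mstar) * deriv (wFun1 V₀ h κ) θ ≥ η * (θ - κ * mstar) ^ 2) ∧
    (∃ K : ℝ, ConvexOn ℝ Set.univ (fun θ => wFun1 V₀ h κ θ - K / 2 * θ ^ 2)) := by
  have hκ0 : 0 < κ := by rw [hκ]; positivity
  have hVc' : Continuous V := hV.continuous
  have hUc : Continuous V₀ := by
    rw [funext hV₀]
    fun_prop
  have hVs : SuperQuadratic V := superQuadratic_of_rpow_le (hV.differentiable two_ne_zero) hβ
    fun x hx => (hgrow x hx).1
  have hU : SuperQuadratic V₀ := fun A => by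
    obtain ⟨C, hC⟩ := hVs (A * σ ^ 2)
    refine ⟨C / σ ^ 2, fun x => ?_⟩
    rw [hV₀, le_div_iff₀ (by positivity), sub_mul, div_mul_cancel₀ _ (by positivity)]
    nlinarith [hC x, sq_nonneg x]
  have hf : ∀ m, fFun σ V m = gibbsMean V₀ (κ * m) := fun m => by
    rw [hκ, fFun_eq_gibbsMean hσ hV₀]
  have hg : ∀ t, gibbsMean V₀ t = fFun σ V (t / κ) := fun t => by
    rw [hf, mul_div_cancel₀ t hκ0.ne']
  have hgmono : StrictMono (gibbsMean V₀) := fun s t hst => by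
    rw [hg, hg]
    exact hfmono (div_lt_div_of_pos_right hst hκ0)
  have hgc : Continuous (gibbsMean V₀) :=
    continuous_iff_continuousAt.2 fun t => (hU.hasDerivAt_gibbsMean hUc t).continuousAt
  have hfc : Continuous (fFun σ V) := by
    rw [funext hf]
    fun_prop
  have hrc : Continuous r := hrC2.continuous
  have hderiv : ∀ θ, HasDerivAt (wFun1 V₀ h κ) (θ / κ - fFun σ V (r θ / κ)) θ := fun θ => by
    rw [← hg]
    exact hU.hasDerivAt_wFun1 hUc (ginv := fun u => κ * finv u) mstar κ hgmono
      (fun t => by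
        dsimp only
        rw [hg, hfinvL, mul_div_cancel₀ t hκ0.ne'])
      (fun u => by
        dsimp only
        rw [← hf, hfinvR]) hrmono hrc hrinvL hrinvR hhdef θ
  have hrlip : ∀ ⦃s t⦄, s ≤ t → r t - r s ≤ 1 * (t - s) := fun s t hst =>
    image_sub_le_mul_sub_of_deriv_le (hrC2.differentiable two_ne_zero)
      (fun z => (hr4 z).2) hst
  have hrge : ∀ z, z ≤ r z := fun z => by
    rcases le_total a' z with hz | hz
    · exact (hr1 z hz).ge
    · have := hrlip hz
      rw [hr1 a' le_rfl] at this
      linarith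
  have ha'lt : a' < κ * mstar := by
    rw [ha']
    refine mul_lt_mul_of_pos_left (hfmono.lt_iff_lt.1 ?_) hκ0
    rwa [hfinvR, hfixstar]
  have hfle : ∀ θ, fFun σ V (θ / κ) ≤ fFun σ V (r θ / κ) := fun θ =>
    hfmono.monotone (div_le_div_of_nonneg_right (hrge θ) hκ0.le)
  obtain ⟨T, hT⟩ := hU.exists_mul_gibbsMean_le hUc (b := 1 / (2 * κ)) (by positivity)
  have hTpos : ∀ t, 0 < t → T ≤ t → gibbsMean V₀ t ≤ t / (2 * κ) := fun t h0 ht => by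
    have := hT t (ht.trans (le_abs_self t))
    refine le_of_mul_le_mul_left (this.trans_eq ?_) h0
    ring
  have hTneg : ∀ t, t < 0 → T ≤ -t → t / (2 * κ) ≤ gibbsMean V₀ t := fun t h0 ht => by
    have := hT t (ht.trans (neg_le_abs t))
    refine le_of_mul_le_mul_left ?_ (neg_pos.2 h0)
    have e : t * (t / (2 * κ)) = 1 / (2 * κ) * t ^ 2 := by ring
    linarith
  -- the sign of `f m - m` on each side of the fixed points
  have hright : ∀ m, mstar < m → fFun σ V m < m := fun m hm => by
    set t := max (max T 1) (κ * (mstar + 1)) with ht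
    have ht1 : 1 ≤ t := (le_max_right _ _).trans (le_max_left _ _)
    have hlt : fFun σ V (t / κ) < t / κ := by
      rw [← hg]
      refine (hTpos t (by linarith) ((le_max_left _ _).trans (le_max_left _ _))).trans_lt ?_
      exact div_lt_div_of_pos_left (by linarith) hκ0 (by linarith)
    have hmem : mstar < t / κ := by
      rw [lt_div_iff₀ hκ0]
      have : κ * (mstar + 1) ≤ t := le_max_right _ _
      linarith
    refine sub_pos.1 (ContinuousOn.pos_of_ne_zero (s := Ioi mstar)
      (D := fun m => m - fFun σ V m) (by fun_prop) ordConnected_Ioi (fun y hy e => ?_)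
      hmem (sub_pos.2 hlt) hm)
    exact (ne_of_gt (mem_Ioi.1 hy)) (huniqD y (ha.le.trans (mem_Ioi.1 hy).le)
      (sub_eq_zero.1 e).symm)
  have hleft : ∀ m, m < mminus → m < fFun σ V m := fun m hm => by
    set t := min (min (-T) (-1)) (κ * (mminus - 1)) with ht
    have ht1 : t ≤ -1 := (min_le_left _ _).trans (min_le_right _ _)
    have htT : t ≤ -T := (min_le_left _ _).trans (min_le_left _ _)
    have hlt : t / κ < fFun σ V (t / κ) := by
      rw [← hg]
      refine lt_of_lt_of_le ?_ (hTneg t (by linarith) (by linarith))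
      rw [div_lt_div_iff₀ hκ0 (by positivity)]
      nlinarith
    have hmem : t / κ < mminus := by
      rw [div_lt_iff₀ hκ0]
      have : t ≤ κ * (mminus - 1) := min_le_right _ _
      linarith
    refine sub_pos.1 (ContinuousOn.pos_of_ne_zero (s := Iio mminus)
      (D := fun m => fFun σ V m - m) (by fun_prop) ordConnected_Iio (fun y hy e => ?_)
      hmem (sub_pos.2 hlt) hm)
    exact hnofixbelow y hy (sub_eq_zero.1 e)
  have hdiff : HasDerivAt (fFun σ V) (deriv (fFun σ V) mstar) mstar :=
    (differentiableAt_of_deriv_ne_zero hf'pos.ne').hasDerivAt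
  have hmid : ∀ m, a - ε ≤ m → m < mstar → m < fFun σ V m := fun m hm hm' => by
    have hslope := (hasDerivAt_iff_tendsto_slope.1 hdiff).eventually_lt_const hf'lt
    obtain ⟨y, hy, hya, hym⟩ := ((hslope.filter_mono (nhdsLT_le_nhdsNE mstar)).and
      (Ioo_mem_nhdsLT ha)).exists
    have hlt : y < fFun σ V y := by
      rw [slope_comm, slope_def_field, div_lt_one (sub_pos.2 hym), hfixstar] at hy
      linarith
    refine sub_pos.1 (ContinuousOn.pos_of_ne_zero (s := Ico (a - ε) mstar)
      (D := fun m => fFun σ V m - m) (by fun_prop) ordConnected_Ico (fun z hz e => ?_)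
      ⟨by linarith, hym⟩ (sub_pos.2 hlt) ⟨hm, hm'⟩)
    rcases le_total z a with hza | hza
    · exact hnofixnear z hz.1 hza (sub_eq_zero.1 e)
    · exact hz.2.ne (huniqD z hza (sub_eq_zero.1 e))
  have hmminus' : mminus < a - ε := by
    by_contra! hle
    exact hnofixnear mminus hle hmminus.le hfixminus
  have hbelow : ∀ θ, θ < κ * mstar → θ / κ < fFun σ V (r θ / κ) := fun θ hθ => by
    rcases le_or_gt (a - ε) (θ / κ) with h1 | h1
    · refine (hmid _ h1 ?_).trans_le (hfle θ)
      rwa [div_lt_iff₀ hκ0, mul_comm]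
    rcases lt_or_ge (θ / κ) mminus with h2 | h2
    · exact (hleft _ h2).trans_le (hfle θ)
    · refine h1.trans_le ?_
      rw [← hfinvR (a - ε)]
      refine hfmono.monotone ?_
      rw [le_div_iff₀ hκ0, mul_comm, ← ha'']
      refine hr2.trans (hrmono.monotone ?_)
      rwa [le_div_iff₀ hκ0, mul_comm] at h2
  have habove : ∀ θ, κ * mstar < θ → fFun σ V (r θ / κ) < θ / κ := fun θ hθ => by
    rw [hr1 θ (ha'lt.trans hθ).le]
    refine hright _ ?_
    rwa [lt_div_iff₀ hκ0, mul_comm]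
  have hcrit : κ * mstar / κ - fFun σ V (r (κ * mstar) / κ) = 0 := by
    rw [hr1 _ ha'lt.le, mul_div_cancel_left₀ _ hκ0.ne', hfixstar, sub_self]
  obtain ⟨η, hη, hcoer⟩ : ∃ η, 0 < η ∧ ∀ θ, η * (θ - κ * mstar) ^ 2 ≤
      (θ - κ * mstar) * (θ / κ - fFun σ V (r θ / κ)) := by
    refine exists_coercive (q := fun θ => θ / κ - fFun σ V (r θ / κ))
      (q' := 1 / κ - deriv (fFun σ V) mstar * (1 / κ)) (η₀ := 1 / (4 * κ)) (by fun_prop) hcrit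
      ?_ ?_ (fun θ hθ => ?_) (by positivity) ?_
    · have hcomp : HasDerivAt (fun θ => θ / κ - fFun σ V (θ / κ))
          (1 / κ - deriv (fFun σ V) mstar * (1 / κ)) (κ * mstar) := by
        have hid := (hasDerivAt_id (κ * mstar)).div_const κ
        refine hid.sub (HasDerivAt.comp (κ * mstar) (h₂ := fFun σ V) ?_ hid)
        simpa [mul_div_cancel_left₀ _ hκ0.ne'] using hdiff
      refine hcomp.congr_of_eventuallyEq ?_
      filter_upwards [lt_mem_nhds ha'lt] with θ hθ
      rw [hr1 θ hθ.le]
    · rw [← one_sub_mul]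
      exact mul_pos (sub_pos.2 hf'lt) (by positivity)
    · rcases hθ.lt_or_gt with hlt | hlt
      · exact mul_pos_of_neg_of_neg (sub_neg.2 hlt) (sub_neg.2 (hbelow θ hlt))
      · exact mul_pos (sub_pos.2 hlt) (sub_pos.2 (habove θ hlt))
    · have hev := (tendsto_norm_cocompact_atTop (E := ℝ)).eventually_ge_atTop
        (max (max T 1) |κ * mstar|)
      filter_upwards [hev] with θ hθ
      have hθT : T ≤ |θ| := ((le_max_left _ _).trans (le_max_left _ _)).trans hθ
      have hθ1 : 1 ≤ |θ| := ((le_max_right _ _).trans (le_max_left _ _)).trans hθ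
      have hθc : |κ * mstar| ≤ |θ| := (le_max_right _ _).trans hθ
      have hhalf : θ / κ - θ / (2 * κ) = θ / (2 * κ) := by
        field_simp
        ring
      suffices (θ - κ * mstar) * (θ / (2 * κ)) ≤
          (θ - κ * mstar) * (θ / κ - fFun σ V (r θ / κ)) by
        refine le_trans ?_ this
        have e : (θ - κ * mstar) * (θ / (2 * κ)) - 1 / (4 * κ) * (θ - κ * mstar) ^ 2 =
            (θ ^ 2 - (κ * mstar) ^ 2) / (4 * κ) := by
          field_simp
          ring
        have : 0 ≤ (θ ^ 2 - (κ * mstar) ^ 2) / (4 * κ) :=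
          div_nonneg (sub_nonneg.2 (sq_le_sq.2 hθc)) (by positivity)
        linarith
      rcases le_total 0 θ with h0 | h0
      · rw [abs_of_nonneg h0] at hθT hθ1 hθc
        have hcθ : κ * mstar ≤ θ := (le_abs_self _).trans hθc
        refine mul_le_mul_of_nonneg_left ?_ (sub_nonneg.2 hcθ)
        rw [hr1 θ (ha'lt.le.trans hcθ), ← hg]
        linarith [hTpos θ (by linarith) hθT]
      · rw [abs_of_nonpos h0] at hθT hθ1 hθc
        have hcθ : θ ≤ κ * mstar := by linarith [neg_abs_le (κ * mstar)]
        refine mul_le_mul_of_nonpos_left ?_ (sub_nonpos.2 hcθ)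
        have := hfle θ
        rw [← hg] at this
        linarith [hTneg θ (by linarith) hθT]
  have hdw : ∀ θ, deriv (wFun1 V₀ h κ) θ = θ / κ - fFun σ V (r θ / κ) :=
    fun θ => (hderiv θ).deriv
  refine ⟨hderiv, fun θ => ?_, ⟨η, hη, fun θ => ?_⟩, ?_⟩
  · rw [hdw]
    refine ⟨fun h0 => ?_, fun h0 => by rw [h0, hcrit]⟩
    have := hcoer θ
    rw [h0, mul_zero] at this
    have h2 : (θ - κ * mstar) ^ 2 ≤ 0 := nonpos_of_mul_nonpos_right this hη
    exact sub_eq_zero.1 (pow_eq_zero_iff two_ne_zero |>.1 (h2.antisymm (sq_nonneg _)))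
  · rw [hdw]
    exact hcoer θ
  · set Λ := exp (2 * (Mb / σ ^ 2)) / ((ρ₀ + 1) / σ ^ 2) with hΛ
    have hΛ0 : 0 ≤ Λ := by positivity
    have hlip : ∀ ⦃s t⦄, s ≤ t → gibbsMean V₀ t - gibbsMean V₀ s ≤ Λ * (t - s) := fun s t hst =>
      hU.gibbsMean_sub_le hUc (Q := fun x => (Vc x + x ^ 2 / 2) / σ ^ 2) (by positivity)
        (by
          have hconv := (strongConvexOn_iff_convex.1 hVc).smul
            (by positivity : (0 : ℝ) ≤ 1 / σ ^ 2)
          convert! hconv using 1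
          ext x
          simp only [norm_eq_abs, sq_abs, smul_eq_mul]
          field_simp
          ring)
        (fun x => by
          have e : V₀ x - (Vc x + x ^ 2 / 2) / σ ^ 2 = Vb x / σ ^ 2 := by
            rw [hV₀, hdec]
            ring
          rw [e, abs_div, abs_of_pos (by positivity : (0 : ℝ) < σ ^ 2)]
          exact div_le_div_of_nonneg_right (hVb x) (by positivity)) hst
    refine ⟨-Λ, ?_⟩
    have hd : ∀ θ, HasDerivAt (fun θ => wFun1 V₀ h κ θ - -Λ / 2 * θ ^ 2)
        (θ / κ - gibbsMean V₀ (r θ) + Λ * θ) θ := fun θ => by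
      rw [hg]
      refine ((hderiv θ).sub ((hasDerivAt_pow 2 θ).const_mul (-Λ / 2))).congr_deriv ?_
      simp only [Nat.cast_ofNat, Nat.add_one_sub_one, pow_one]
      ring
    refine Monotone.convexOn_univ_of_deriv (fun θ => (hd θ).differentiableAt) fun s t hst => ?_
    rw [(hd s).deriv, (hd t).deriv]
    have h1 := hlip (hrmono.monotone hst)
    have h2 := mul_le_mul_of_nonneg_left (hrlip hst) hΛ0
    have h3 : s / κ ≤ t / κ := div_le_div_of_nonneg_right hst hκ0.le
    linarith

end
end
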